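/- Let G be an internally 3-connected graph that has an S-restricted drawing. Then there exists a chord description Ψ of G. Moreover, in the construction one may choose the flags so that at most two chord-tied pairs in Ψ carry the same chord edge and flag; this is possible because in a suitable S-restricted drawing of G at most two pairs of crossing edges share any given chord edge. -/

import Mathlib

open scoped unitInterval

namespace OnePlanarity

/-- The six crossing types of a crossing in a 1-planar drawing. -/
inductive CrossingType : Type
  | full | almostFull | bowtie | arrow | chair | timesCross
  deriving DecidableEq

/-- The three crossing types in which the four endpoints of the crossing edges
lie on a common 4-cycle using the two crossing edges. -/
def goodTypes : Set CrossingType :=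
  {CrossingType.full, CrossingType.almostFull, CrossingType.bowtie}

/-- The three "bad" crossing types. -/
def badTypes : Set CrossingType :=
  {CrossingType.arrow, CrossingType.chair, CrossingType.timesCross}

variable {V : Type*} {W : Type*}

/-- `HasCrossingType G a b c d t` says that, assuming the edges `ab` and `cd` of `G`
cross, the subgraph of `G` induced by `{a,b,c,d}` witnesses the crossing type `t`. -/
def HasCrossingType (G : SimpleGraph V) (a b c d : V) : CrossingType → Prop
  | .full => G.Adj a c ∧ G.Adj a d ∧ G.Adj b c ∧ G.Adj b d
  | .almostFull =>
      (¬G.Adj a c ∧ G.Adj a d ∧ G.Adj b c ∧ G.Adj b d) ∨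
      (G.Adj a c ∧ ¬G.Adj a d ∧ G.Adj b c ∧ G.Adj b d) ∨
      (G.Adj a c ∧ G.Adj a d ∧ ¬G.Adj b c ∧ G.Adj b d) ∨
      (G.Adj a c ∧ G.Adj a d ∧ G.Adj b c ∧ ¬G.Adj b d)
  | .bowtie =>
      (G.Adj a c ∧ G.Adj b d ∧ ¬G.Adj a d ∧ ¬G.Adj b c) ∨
      (G.Adj a d ∧ G.Adj b c ∧ ¬G.Adj a c ∧ ¬G.Adj b d)
  | .arrow =>
      (G.Adj a c ∧ G.Adj a d ∧ ¬G.Adj b c ∧ ¬G.Adj b d) ∨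
      (G.Adj b c ∧ G.Adj b d ∧ ¬G.Adj a c ∧ ¬G.Adj a d) ∨
      (G.Adj a c ∧ G.Adj b c ∧ ¬G.Adj a d ∧ ¬G.Adj b d) ∨
      (G.Adj a d ∧ G.Adj b d ∧ ¬G.Adj a c ∧ ¬G.Adj b c)
  | .chair =>
      (G.Adj a c ∧ ¬G.Adj a d ∧ ¬G.Adj b c ∧ ¬G.Adj b d) ∨
      (¬G.Adj a c ∧ G.Adj a d ∧ ¬G.Adj b c ∧ ¬G.Adj b d) ∨
      (¬G.Adj a c ∧ ¬G.Adj a d ∧ G.Adj b c ∧ ¬G.Adj b d) ∨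
      (¬G.Adj a c ∧ ¬G.Adj a d ∧ ¬G.Adj b c ∧ G.Adj b d)
  | .timesCross => ¬G.Adj a c ∧ ¬G.Adj a d ∧ ¬G.Adj b c ∧ ¬G.Adj b d

/-- `IsArc A x y` says that `A` is the image of a simple curve from `x` to `y`. -/
def IsArc (A : Set (ℝ × ℝ)) (x y : ℝ × ℝ) : Prop :=
  ∃ f : I → ℝ × ℝ, Continuous f ∧ Function.Injective f ∧
    f 0 = x ∧ f 1 = y ∧ Set.range f = A

/-- A drawing of a graph `G` in the plane: vertices are mapped to distinct points,
every edge is mapped to a simple curve between the images of its endpoints avoiding the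
images of all other vertices, and two edges intersect in finitely many points. -/
structure Drawing (G : SimpleGraph V) where
  pos : V → ℝ × ℝ
  pos_inj : Function.Injective pos
  arc : Sym2 V → Set (ℝ × ℝ)
  arc_curve : ∀ e ∈ G.edgeSet, ∀ u v : V, e = s(u, v) → IsArc (arc e) (pos u) (pos v)
  arc_avoid : ∀ e ∈ G.edgeSet, ∀ w : V, pos w ∈ arc e → w ∈ e
  arc_finite_inter : ∀ e ∈ G.edgeSet, ∀ e' ∈ G.edgeSet, e ≠ e' →
    (arc e ∩ arc e').Finite

variable {G : SimpleGraph V}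

/-- `D.Crosses e e' p` : the distinct edges `e` and `e'` of `G` cross at the point `p`
(an intersection point of their curves which is not the image of a vertex). -/
def Drawing.Crosses (D : Drawing G) (e e' : Sym2 V) (p : ℝ × ℝ) : Prop :=
  e ∈ G.edgeSet ∧ e' ∈ G.edgeSet ∧ e ≠ e' ∧
    p ∈ D.arc e ∧ p ∈ D.arc e' ∧ p ∉ Set.range D.pos

/-- A drawing is 1-planar if every edge is involved in at most one crossing and
adjacent edges do not cross. -/
def Drawing.IsOnePlanar (D : Drawing G) : Prop :=
  (∀ e e₁ e₂ p q, D.Crosses e e₁ p → D.Crosses e e₂ q → e₁ = e₂ ∧ p = q) ∧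
  (∀ e e' p, D.Crosses e e' p → ∀ v : V, v ∈ e → v ∉ e')

/-- A drawing is `S`-restricted if it is 1-planar and every crossing has a type in `S`. -/
def Drawing.IsSRestricted (D : Drawing G) (S : Set CrossingType) : Prop :=
  D.IsOnePlanar ∧
  ∀ a b c d : V, ∀ p : ℝ × ℝ, D.Crosses s(a, b) s(c, d) p →
    ∃ t ∈ S, HasCrossingType G a b c d t

/-- A graph is 1-planar if it admits a 1-planar drawing. -/
def IsOnePlanarGraph (G : SimpleGraph V) : Prop :=
  ∃ D : Drawing G, D.IsOnePlanar

/-- A graph is `S`-restricted if it admits an `S`-restricted drawing. -/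
def SRestricted (G : SimpleGraph V) (S : Set CrossingType) : Prop :=
  ∃ D : Drawing G, D.IsSRestricted S

/-- A planar graph: one admitting a crossing-free drawing. -/
def IsPlanarGraph (G : SimpleGraph V) : Prop :=
  ∃ D : Drawing G, ∀ e e' p, ¬ D.Crosses e e' p

/-- A drawing is geometric if every edge is drawn as a straight-line segment. -/
def Drawing.IsGeometric (D : Drawing G) : Prop :=
  ∀ u v : V, G.Adj u v → D.arc s(u, v) = segment ℝ (D.pos u) (D.pos v)

/-- The point set of a drawing. -/
def Drawing.image (D : Drawing G) : Set (ℝ × ℝ) :=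
  Set.range D.pos ∪ ⋃ e ∈ G.edgeSet, D.arc e

/-- The set of points of the outer (unbounded) face of a point set `A`. -/
def outerRegion (A : Set (ℝ × ℝ)) : Set (ℝ × ℝ) :=
  {x | x ∉ A ∧ ¬ Bornology.IsBounded (connectedComponentIn Aᶜ x)}

/-- `Inside γ x` : the point `x` is separated from the outer face by the closed curve `γ`. -/
def Inside (γ : Set (ℝ × ℝ)) (x : ℝ × ℝ) : Prop :=
  x ∉ γ ∧ Bornology.IsBounded (connectedComponentIn γᶜ x)

/-- A vertex lies on (the boundary of) the outer face of a drawing. -/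
def Drawing.OnOuterFace (D : Drawing G) (v : V) : Prop :=
  D.pos v ∈ closure (outerRegion D.image)

/-- Two vertices are cofacial: they lie on the boundary of a common face. -/
def Drawing.Cofacial (D : Drawing G) (u v : V) : Prop :=
  ∃ p : ℝ × ℝ, p ∉ D.image ∧
    D.pos u ∈ closure (connectedComponentIn D.imageᶜ p) ∧
    D.pos v ∈ closure (connectedComponentIn D.imageᶜ p)

/-- A graph admits a geometric `S`-restricted drawing. -/
def GeoSRestricted (G : SimpleGraph V) (S : Set CrossingType) : Prop :=
  ∃ D : Drawing G, D.IsGeometric ∧ D.IsSRestricted S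

/-- `OGeoSRestricted G S O` : the graph `G` admits a geometric `S`-restricted drawing
in which the vertex of `O` (if any) lies on the outer face. -/
def OGeoSRestricted (G : SimpleGraph V) (S : Set CrossingType) (O : Set V) : Prop :=
  ∃ D : Drawing G, D.IsGeometric ∧ D.IsSRestricted S ∧ ∀ v ∈ O, D.OnOuterFace v

/-- `k`-connectivity. -/
def KConnected (k : ℕ) (G : SimpleGraph V) : Prop :=
  k < Nat.card V ∧ ∀ T : Set V, T.ncard < k → (G.induce Tᶜ).Connected

/-- A vertex has degree exactly two. -/
def DegTwo (G : SimpleGraph V) (w : V) : Prop :=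
  ∃ a b : V, a ≠ b ∧ G.neighborSet w = {a, b}

/-- The simple graph obtained from `G` by suppressing the degree-2 vertices in `W`. -/
def suppress (G : SimpleGraph V) (Ws : Set V) : SimpleGraph {v : V // v ∉ Ws} :=
  SimpleGraph.fromRel (fun a b =>
    G.Adj a.1 b.1 ∨ ∃ w ∈ Ws, G.Adj w a.1 ∧ G.Adj w b.1)

/-- A graph is internally 3-connected if it is obtained from a 3-connected (multi)graph by
subdividing a subset of its edges once each. -/
def InternallyThreeConnected (G : SimpleGraph V) : Prop :=
  ∃ Ws : Set V, (∀ w ∈ Ws, DegTwo G w) ∧ (∀ w ∈ Ws, ∀ u ∈ Ws, ¬ G.Adj w u) ∧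
    KConnected 3 (suppress G Ws)

/-- `IsSeparation G T X₁ X₂` : `(X₁, X₂)` is a separation of `G` induced by the separator `T`. -/
def IsSeparation (G : SimpleGraph V) (T X₁ X₂ : Set V) : Prop :=
  X₁ ∪ X₂ = Set.univ ∧ X₁ ∩ X₂ = T ∧ (X₁ \ T).Nonempty ∧ (X₂ \ T).Nonempty ∧
  ∀ u ∈ X₁ \ T, ∀ v ∈ X₂ \ T, ∀ p : G.Walk u v, ∃ w ∈ T, w ∈ p.support

end OnePlanarity
namespace OnePlanarity

variable {V : Type*}

/-- A graph is chordal if every cycle of length at least 4 has a chord. -/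
def IsChordal (G : SimpleGraph V) : Prop :=
  ∀ (v : V) (c : G.Walk v v), c.IsCycle → 4 ≤ c.length →
    ∃ a b : V, a ∈ c.support ∧ b ∈ c.support ∧ G.Adj a b ∧ s(a, b) ∉ c.edges

/-- `(e, g)` is a chord-tied pair (w.r.t. a chordal completion `Ĝ` of `G` and the set `S`
of admissible crossing types): `e = ab` is the crossing edge of a 4-cycle `a b c d` of `G`
whose vertices induce a crossing type from `S` in which `ab` and `cd` cross, and `g` is a
chord of this 4-cycle in `Ĝ`. -/
def IsChordTiedPair (G Ghat : SimpleGraph V) (S : Set CrossingType) (e g : Sym2 V) : Prop :=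
  ∃ a b c d : V, e = s(a, b) ∧
    G.Adj a b ∧ G.Adj b c ∧ G.Adj c d ∧ G.Adj d a ∧
    (∃ t ∈ S, HasCrossingType G a b c d t) ∧
    g ∈ Ghat.edgeSet ∧ (∀ x ∈ g, x ∈ ({a, b, c, d} : Set V)) ∧
    g ∉ ({s(a, b), s(b, c), s(c, d), s(d, a)} : Set (Sym2 V))

/-- `{e, e'}` is a crossing pair of the set `Ψ` of flagged chord-tied pairs: `e ≠ e'` and
`e` and `e'` are crossing edges of chord-tied pairs in `Ψ` with the same chord edge and
the same flag. -/
def CrossingPairOf (Ψ : Set (Sym2 V × Sym2 V × Bool)) (e e' : Sym2 V) : Prop :=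
  e ≠ e' ∧ ∃ (g : Sym2 V) (b : Bool), (e, g, b) ∈ Ψ ∧ (e', g, b) ∈ Ψ

/-- The graph obtained from `G` by replacing each pair of edges in `CP` by a 4-claw on
their endpoints (with a new centre vertex `Sum.inr P` for each pair `P ∈ CP`). -/
def planarizationBy (G : SimpleGraph V) (CP : Set (Sym2 (Sym2 V))) :
    SimpleGraph (V ⊕ Sym2 (Sym2 V)) :=
  SimpleGraph.fromRel (fun x y =>
    (∃ u w : V, x = Sum.inl u ∧ y = Sum.inl w ∧ G.Adj u w ∧ ∀ P ∈ CP, s(u, w) ∉ P) ∨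
    (∃ (u : V) (P : Sym2 (Sym2 V)), x = Sum.inl u ∧ y = Sum.inr P ∧ P ∈ CP ∧
      ∃ e ∈ P, u ∈ e))

/-- The crossing pairs of `Ψ`, as elements of `Sym2 (Sym2 V)`. -/
def crossingPairsOf (Ψ : Set (Sym2 V × Sym2 V × Bool)) : Set (Sym2 (Sym2 V)) :=
  {P | ∃ e e', CrossingPairOf Ψ e e' ∧ P = s(e, e')}

/-- A chord description of `G` (w.r.t. a chordal completion `Ĝ` and crossing types `S`):
a set `Ψ` of flagged chord-tied pairs `(e, g, b)` such that (1) every chord-tied pair in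
`Ψ` has exactly one partner in `Ψ` with the same chord edge and flag, (2) every edge is
the crossing edge of at most one chord-tied pair in `Ψ`, (3) replacing every crossing pair
of `Ψ` by a 4-claw yields a planar graph, and (4) the endpoints of every crossing pair of
`Ψ` induce a crossing type from `S` in which its two edges cross. -/
def IsChordDescription (G Ghat : SimpleGraph V) (S : Set CrossingType)
    (Ψ : Set (Sym2 V × Sym2 V × Bool)) : Prop :=
  (∀ ψ ∈ Ψ, IsChordTiedPair G Ghat S ψ.1 ψ.2.1) ∧
  (∀ ψ ∈ Ψ, ∃! e' : Sym2 V, e' ≠ ψ.1 ∧ (e', ψ.2.1, ψ.2.2) ∈ Ψ) ∧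
  (∀ (e g g' : Sym2 V) (b b' : Bool), (e, g, b) ∈ Ψ → (e, g', b') ∈ Ψ → g = g' ∧ b = b') ∧
  IsPlanarGraph (planarizationBy G (crossingPairsOf Ψ)) ∧
  (∀ e e', CrossingPairOf Ψ e e' →
    ∃ a b c d : V, e = s(a, b) ∧ e' = s(c, d) ∧ ∃ t ∈ S, HasCrossingType G a b c d t)

end OnePlanarity
namespace OnePlanarity

/-- A nowhere vanishing continuous function on a simply connected space has a continuous
logarithm. -/
lemma exists_continuous_log {X : Type*} [TopologicalSpace X] [SimplyConnectedSpace X]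
    [LocallyPathConnectedSpace X] [Nonempty X] {g : X → ℂ} (hg : Continuous g)
    (h0 : ∀ x, g x ≠ 0) :
    ∃ L : X → ℂ, Continuous L ∧ ∀ x, Complex.exp (L x) = g x := by
  obtain ⟨x₀⟩ := ‹Nonempty X›
  obtain ⟨F, ⟨-, hF⟩, -⟩ := Complex.isCoveringMapOn_exp.existsUnique_continuousMap_lifts
    ⟨g, hg⟩ (a₀ := x₀) (e₀ := Complex.log (g x₀)) (Complex.exp_log (h0 x₀)) h0
  exact ⟨F, F.continuous, fun x => congrFun hF x⟩

/-- Two continuous logarithms of the same function on `ℝ` have the same increments. -/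
lemma log_increment_unique {L L' : ℝ → ℂ} (hL : Continuous L) (hL' : Continuous L')
    (h : ∀ t, Complex.exp (L t) = Complex.exp (L' t)) (s t : ℝ) : L t - L s = L' t - L' s := by
  obtain ⟨F, -, hF⟩ := Complex.isCoveringMapOn_exp.existsUnique_continuousMap_lifts
    (⟨fun t => Complex.exp (L t), by fun_prop⟩ : C(ℝ, ℂ)) (a₀ := s) (e₀ := L s) rfl
    (fun _ => Complex.exp_ne_zero _)
  have h1 := hF ⟨L, hL⟩ ⟨rfl, rfl⟩
  have h2 := hF ⟨fun t => L' t + (L s - L' s), by fun_prop⟩ ⟨by simp, by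
    funext t
    simp only [Function.comp, ContinuousMap.coe_mk, Complex.exp_add, Complex.exp_sub, h]
    rw [div_self (Complex.exp_ne_zero _), mul_one]⟩
  have h3 := DFunLike.congr_fun (h1.trans h2.symm) t
  simp only [ContinuousMap.coe_mk] at h3
  rw [h3]; ring

open Classical in
/-- The increment over `[0, 1]` of a continuous logarithm of `g`. -/
noncomputable def logIncrement (g : ℝ → ℂ) : ℂ :=
  if h : ∃ L : ℝ → ℂ, Continuous L ∧ ∀ t, Complex.exp (L t) = g t then
    h.choose 1 - h.choose 0 else 0

lemma logIncrement_eq {g L : ℝ → ℂ} (hL : Continuous L) (h : ∀ t, Complex.exp (L t) = g t) :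
    logIncrement g = L 1 - L 0 := by
  have hex : ∃ L : ℝ → ℂ, Continuous L ∧ ∀ t, Complex.exp (L t) = g t := ⟨L, hL, h⟩
  rw [logIncrement, dif_pos hex]
  exact log_increment_unique hex.choose_spec.1 hL (fun t => by rw [hex.choose_spec.2, h]) 0 1

lemma exp_logIncrement {g : ℝ → ℂ} (hg : Continuous g) (h0 : ∀ t, g t ≠ 0) :
    Complex.exp (logIncrement g) = g 1 / g 0 := by
  obtain ⟨L, hL, h⟩ := exists_continuous_log hg h0
  rw [logIncrement_eq hL h, Complex.exp_sub, h, h]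

/-- Going around the square of differences of two disjoint curves produces no winding. -/
lemma logIncrement_square {γ δ : ℝ → ℂ} (hγ : Continuous γ) (hδ : Continuous δ)
    (h : ∀ s t, γ s ≠ δ t) :
    logIncrement (fun t => γ t - δ 0) + logIncrement (fun t => δ t - γ 1) =
      logIncrement (fun t => δ t - γ 0) + logIncrement (fun t => γ t - δ 1) := by
  obtain ⟨L, hL, hexp⟩ := exists_continuous_log (X := ℝ × ℝ)
    (g := fun x => γ x.1 - δ x.2) (by fun_prop) (fun x => sub_ne_zero.2 (h _ _))
  have hneg : ∀ s, logIncrement (fun t => δ t - γ s) = L (s, 1) - L (s, 0) := fun s => by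
    rw [logIncrement_eq (L := fun t => L (s, t) + Real.pi * Complex.I) (by fun_prop)
      (fun t => by simp [Complex.exp_add, hexp])]
    ring
  have hpos : ∀ s, logIncrement (fun t => γ t - δ s) = L (1, s) - L (0, s) := fun s =>
    logIncrement_eq (L := fun t => L (t, s)) (by fun_prop) (fun t => hexp (t, s))
  rw [hneg, hneg, hpos, hpos]
  ring

/-- A logarithm of `z i' - z i` for distinct points, changing by `π * I` when `i < i'` are
swapped. -/
noncomputable def pairLog (z : Fin 3 → ℂ) (i i' : Fin 3) : ℂ :=
  if i < i' then Complex.log (z i' - z i) else Complex.log (z i - z i') + Real.pi * Complex.I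

lemma exp_pairLog {z : Fin 3 → ℂ} {i i' : Fin 3} (h : z i ≠ z i') :
    Complex.exp (pairLog z i i') = z i' - z i := by
  unfold pairLog
  split_ifs
  · exact Complex.exp_log (sub_ne_zero.2 h.symm)
  · rw [Complex.exp_add, Complex.exp_log (sub_ne_zero.2 h)]; simp

lemma pairLog_swap {z : Fin 3 → ℂ} {i i' : Fin 3} (h : i < i') :
    pairLog z i' i = pairLog z i i' + Real.pi * Complex.I := by
  rw [pairLog, pairLog, if_neg h.asymm, if_pos h]

/-- Topological non-planarity of `K₃,₃`: one cannot join three points to three points by nine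
curves in the plane such that curves with different endpoints are disjoint. -/
theorem not_planar_K33 {l r : Fin 3 → ℂ} {γ : Fin 3 → Fin 3 → ℝ → ℂ}
    (hγ : ∀ i j, Continuous (γ i j)) (h0 : ∀ i j, γ i j 0 = l i) (h1 : ∀ i j, γ i j 1 = r j)
    (hdisj : ∀ i i' j j', i ≠ i' → j ≠ j' → ∀ s t, γ i j s ≠ γ i' j' t) : False := by
  have exne : ∀ j : Fin 3, ∃ j', j ≠ j' := by decide
  have hl : ∀ i i', i ≠ i' → l i ≠ l i' := fun i i' h => by
    simpa [h0] using hdisj i i' 0 1 h (by decide) 0 0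
  have hr : ∀ j j', j ≠ j' → r j ≠ r j' := fun j j' h => by
    simpa [h1] using hdisj 0 1 j j' (by decide) h 1 1
  have hlr : ∀ i j, l i ≠ r j := fun i j => by
    obtain ⟨i', hi⟩ := exne i
    obtain ⟨j', hj⟩ := exne j
    simpa [h0, h1] using hdisj i i' j' j hi hj.symm 0 1
  have hμ : ∀ i j, Complex.exp (Complex.log (r j - l i)) = r j - l i := fun i j =>
    Complex.exp_log (sub_ne_zero.2 (hlr i j).symm)
  have hn : ∀ i i' j, ∃ n : ℤ, i ≠ i' → logIncrement (fun t => γ i' j t - l i) =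
      Complex.log (r j - l i) - pairLog l i i' + n * (2 * Real.pi * Complex.I) := by
    intro i i' j
    by_cases h : i = i'
    · exact ⟨0, fun h' => absurd h h'⟩
    obtain ⟨j', hj⟩ := exne j
    have := exp_logIncrement (g := fun t => γ i' j t - l i) (by have := hγ i' j; fun_prop)
      (fun t => sub_ne_zero.2 (by simpa [h0] using hdisj i' i j j' (Ne.symm h) hj t 0))
    rw [h0, h1, ← hμ, ← exp_pairLog (hl i i' h), ← Complex.exp_sub,
      Complex.exp_eq_exp_iff_exists_int] at this
    obtain ⟨n, hn⟩ := this
    exact ⟨n, fun _ => hn⟩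
  have hm : ∀ j j' i, ∃ n : ℤ, j ≠ j' → logIncrement (fun t => γ i j' t - r j) =
      pairLog r j j' - (Complex.log (r j - l i) + Real.pi * Complex.I)
        + n * (2 * Real.pi * Complex.I) := by
    intro j j' i
    by_cases h : j = j'
    · exact ⟨0, fun h' => absurd h h'⟩
    obtain ⟨i', hi⟩ := exne i
    have := exp_logIncrement (g := fun t => γ i j' t - r j) (by have := hγ i j'; fun_prop)
      (fun t => sub_ne_zero.2 (by simpa [h1] using hdisj i i' j' j hi (Ne.symm h) t 1))
    have h2 : l i - r j = Complex.exp (Complex.log (r j - l i) + Real.pi * Complex.I) := by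
      rw [Complex.exp_add, hμ]; simp
    rw [h0, h1, ← exp_pairLog (hr j j' h), h2, ← Complex.exp_sub,
      Complex.exp_eq_exp_iff_exists_int] at this
    obtain ⟨n, hn⟩ := this
    exact ⟨n, fun _ => hn⟩
  choose n hn using hn
  choose m hm using hm
  have key : ∀ i i' j j', i ≠ i' → j ≠ j' →
      (pairLog l i i' - pairLog l i' i) + (pairLog r j j' - pairLog r j' j) =
      ((n i i' j' + m j' j i - n i' i j - m j j' i' : ℤ) : ℂ) * (2 * Real.pi * Complex.I) := by
    intro i i' j j' hi hj
    have := logIncrement_square (hγ i j) (hγ i' j') (hdisj i i' j j' hi hj)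
    simp only [h0, h1] at this
    rw [hn i' i j hi.symm, hm j j' i' hj, hn i i' j' hi, hm j' j i hj.symm] at this
    push_cast
    linear_combination this
  have hpi : (2 * Real.pi * Complex.I : ℂ) ≠ 0 := by simp [Real.pi_ne_zero]
  have odd : ∀ i i' j j', i < i' → j < j' →
      n i i' j' + m j' j i - n i' i j - m j j' i' = -1 := by
    intro i i' j j' hi hj
    have := key i i' j j' hi.ne hj.ne
    rw [pairLog_swap hi, pairLog_swap hj] at this
    have : ((n i i' j' + m j' j i - n i' i j - m j j' i' : ℤ) : ℂ) = ((-1 : ℤ) : ℂ) := by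
      apply mul_right_cancel₀ hpi
      rw [← this]; push_cast; ring
    exact_mod_cast this
  have even : ∀ i i' j j', i < i' → j < j' →
      n i i' j + m j j' i - n i' i j' - m j' j i' = 0 := by
    intro i i' j j' hi hj
    have := key i i' j' j hi.ne hj.ne'
    rw [pairLog_swap hi, pairLog_swap hj] at this
    have : ((n i i' j + m j j' i - n i' i j' - m j' j i' : ℤ) : ℂ) = ((0 : ℤ) : ℂ) := by
      apply mul_right_cancel₀ hpi
      rw [← this]; push_cast; ring
    exact_mod_cast this
  have a1 := odd 0 1 0 1 (by decide) (by decide)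
  have a2 := odd 0 1 0 2 (by decide) (by decide)
  have a3 := odd 0 1 1 2 (by decide) (by decide)
  have a4 := odd 0 2 0 1 (by decide) (by decide)
  have a5 := odd 0 2 0 2 (by decide) (by decide)
  have a6 := odd 0 2 1 2 (by decide) (by decide)
  have a7 := odd 1 2 0 1 (by decide) (by decide)
  have a8 := odd 1 2 0 2 (by decide) (by decide)
  have a9 := odd 1 2 1 2 (by decide) (by decide)
  have b1 := even 0 1 0 1 (by decide) (by decide)
  have b2 := even 0 1 0 2 (by decide) (by decide)
  have b3 := even 0 1 1 2 (by decide) (by decide)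
  have b4 := even 0 2 0 1 (by decide) (by decide)
  have b5 := even 0 2 0 2 (by decide) (by decide)
  have b6 := even 0 2 1 2 (by decide) (by decide)
  have b7 := even 1 2 0 1 (by decide) (by decide)
  have b8 := even 1 2 0 2 (by decide) (by decide)
  have b9 := even 1 2 1 2 (by decide) (by decide)
  omega

/-! ### Arcs -/

lemma not_planar_K33_joinedIn {l r : Fin 3 → ℝ × ℝ} {Γ : Fin 3 → Fin 3 → Set (ℝ × ℝ)}
    (hΓ : ∀ i j, JoinedIn (Γ i j) (l i) (r j))
    (hdisj : ∀ i i' j j', i ≠ i' → j ≠ j' → Disjoint (Γ i j) (Γ i' j')) : False := by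
  choose γ hγ using hΓ
  refine not_planar_K33 (l := fun i => Complex.equivRealProdCLM.symm (l i))
    (r := fun j => Complex.equivRealProdCLM.symm (r j))
    (γ := fun i j t => Complex.equivRealProdCLM.symm ((γ i j).extend t))
    (fun i j => Complex.equivRealProdCLM.symm.continuous.comp (γ i j).continuous_extend)
    (fun i j => by simp) (fun i j => by simp) ?_
  intro i i' j j' hi hj s t h
  have h := Complex.equivRealProdCLM.symm.injective h
  exact Set.disjoint_left.1 (hdisj i i' j j' hi hj) (hγ i j _) (h ▸ hγ i' j' _)

section Arc

variable {A B : Set (ℝ × ℝ)} {x y p : ℝ × ℝ}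

lemma IsArc.symm (h : IsArc A x y) : IsArc A y x := by
  obtain ⟨f, hf, hi, h0, h1, hr⟩ := h
  refine ⟨f ∘ σ, hf.comp unitInterval.continuous_symm, hi.comp unitInterval.symm_bijective.1,
    by simp [h1], by simp [h0], ?_⟩
  rw [Set.range_comp, unitInterval.symm_bijective.2.range_eq, Set.image_univ, hr]

lemma IsArc.left_mem (h : IsArc A x y) : x ∈ A := by
  obtain ⟨f, -, -, h0, -, rfl⟩ := h
  exact ⟨0, h0⟩

lemma IsArc.right_mem (h : IsArc A x y) : y ∈ A := h.symm.left_mem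

lemma IsArc.ne (h : IsArc A x y) : x ≠ y := by
  obtain ⟨f, -, hi, rfl, rfl, -⟩ := h
  exact fun h => zero_ne_one (hi h)

lemma IsArc.isCompact (h : IsArc A x y) : IsCompact A := by
  obtain ⟨f, hf, -, -, -, rfl⟩ := h
  exact isCompact_range hf

lemma IsArc.joinedIn (h : IsArc A x y) : JoinedIn A x y := by
  obtain ⟨f, hf, -, h0, h1, rfl⟩ := h
  exact ⟨⟨⟨f, hf⟩, h0, h1⟩, fun t => ⟨t, rfl⟩⟩

lemma IsArc.concat (hA : IsArc A x p) (hB : IsArc B p y) (h : A ∩ B ⊆ {p}) :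
    IsArc (A ∪ B) x y := by
  obtain ⟨f, hf, hfi, f0, f1, rfl⟩ := hA
  obtain ⟨g, hg, hgi, g0, g1, rfl⟩ := hB
  let F : Path x p := ⟨⟨f, hf⟩, f0, f1⟩
  let G : Path p y := ⟨⟨g, hg⟩, g0, g1⟩
  have aux : ∀ s t : I, f s = g t → s = 1 ∧ t = 0 := fun s t hst => by
    have hs : f s = p := h ⟨⟨s, rfl⟩, ⟨t, hst.symm⟩⟩
    exact ⟨hfi (hs.trans f1.symm), hgi ((hst.symm.trans hs).trans g0.symm)⟩
  refine ⟨F.trans G, (F.trans G).continuous, ?_, (F.trans G).source, (F.trans G).target,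
    F.trans_range G⟩
  intro s t hst
  rw [Path.trans_apply, Path.trans_apply] at hst
  have hsI := s.2
  have htI := t.2
  split_ifs at hst with h1 h2 h2
  · have := congrArg Subtype.val (hfi hst)
    simp only at this
    exact Subtype.ext (by linarith)
  · have := congrArg Subtype.val (aux _ _ hst).2
    simp only [Set.Icc.coe_zero] at this
    exact absurd (by linarith) h2
  · have := congrArg Subtype.val (aux _ _ hst.symm).2
    simp only [Set.Icc.coe_zero] at this
    exact absurd (by linarith) h1
  · have := congrArg Subtype.val (hgi hst)
    simp only at this
    exact Subtype.ext (by linarith)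

lemma isArc_image_Icc {f : I → ℝ × ℝ} (hf : Continuous f) (hi : Function.Injective f)
    {a b : I} (hab : a < b) : IsArc (f '' Set.Icc a b) (f a) (f b) := by
  have hab' : (a : ℝ) < b := hab
  let φ : I → I := fun s => ⟨a + s * (b - a), by
    have := s.2.1
    have := s.2.2
    have := a.2.1
    have := b.2.2
    constructor <;> nlinarith⟩
  have hφ : Continuous φ := by
    apply Continuous.subtype_mk
    fun_prop
  refine ⟨f ∘ φ, hf.comp hφ, hi.comp ?_, ?_, ?_, ?_⟩
  · intro s t hst
    have h := congrArg Subtype.val hst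
    simp only [φ, add_right_inj] at h
    exact Subtype.ext (mul_right_cancel₀ (sub_ne_zero.2 hab'.ne') h)
  · simp [φ]
  · simp [φ]
  · rw [Set.range_comp]
    congr 1
    ext t
    simp only [Set.mem_range, Set.mem_Icc]
    constructor
    · rintro ⟨s, rfl⟩
      have := s.2.1
      have := s.2.2
      constructor <;> rw [← Subtype.coe_le_coe] <;> simp only [φ] <;> nlinarith
    · rintro ⟨h1, h2⟩
      have h1' : (a : ℝ) ≤ t := h1
      have h2' : (t : ℝ) ≤ b := h2
      have hpos : (0 : ℝ) < b - a := sub_pos.2 hab'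
      refine ⟨⟨(t - a) / (b - a), div_nonneg (by linarith) hpos.le,
        (div_le_one hpos).2 (by linarith)⟩, Subtype.ext ?_⟩
      simp only [φ]
      field_simp
      ring

/-- An arc can be cut at an interior point. -/
lemma IsArc.split (h : IsArc A x y) (hp : p ∈ A) (hx : p ≠ x) (hy : p ≠ y) :
    ∃ A₁ A₂, IsArc A₁ x p ∧ IsArc A₂ p y ∧ A₁ ∪ A₂ = A ∧ A₁ ∩ A₂ = {p} := by
  obtain ⟨f, hf, hi, rfl, rfl, rfl⟩ := h
  obtain ⟨t, rfl⟩ := hp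
  have h0 : 0 < t := lt_of_le_of_ne unitInterval.nonneg' (fun h => hx (h ▸ rfl))
  have h1 : t < 1 := lt_of_le_of_ne unitInterval.le_one' (fun h => hy (h ▸ rfl))
  refine ⟨_, _, isArc_image_Icc hf hi h0, isArc_image_Icc hf hi h1, ?_, ?_⟩
  · rw [← Set.image_union, Set.Icc_union_Icc_eq_Icc h0.le h1.le, ← Set.image_univ]
    congr 1
    ext s
    simp [unitInterval.le_one']
  · rw [← Set.image_inter hi, Set.Icc_inter_Icc_eq_singleton h0.le h1.le, Set.image_singleton]

/-- The part of an arc after it has left a closed set for the last time. -/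
lemma IsArc.exists_tail {K : Set (ℝ × ℝ)} (h : IsArc A x y) (hK : IsClosed K) (hx : x ∈ K)
    (hy : y ∉ K) : ∃ q A', IsArc A' q y ∧ A' ⊆ A ∧ A' ∩ K = {q} ∧ q ∈ closure Kᶜ := by
  obtain ⟨f, hf, hi, rfl, rfl, rfl⟩ := h
  obtain ⟨t, htK, ht⟩ := (hK.preimage hf).isCompact.exists_isGreatest ⟨0, hx⟩
  have ht1 : t < 1 := lt_of_le_of_ne unitInterval.le_one' (fun h => hy (h ▸ htK))
  refine ⟨f t, _, isArc_image_Icc hf hi ht1, Set.image_subset_range _ _, ?_, ?_⟩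
  · ext z
    constructor
    · rintro ⟨⟨s, hs, rfl⟩, hz⟩
      rw [le_antisymm (ht hz) hs.1]
      rfl
    · rintro rfl
      exact ⟨⟨t, ⟨le_rfl, ht1.le⟩, rfl⟩, htK⟩
  · have : t ∈ closure (Set.Ioi t) := by
      rw [closure_Ioi' (⟨1, ht1⟩ : (Set.Ioi t).Nonempty)]
      exact Set.self_mem_Ici
    exact map_mem_closure hf this fun s hs hsK => absurd (ht hsK) (not_le.2 hs)

lemma isArc_segment (h : x ≠ y) : IsArc (segment ℝ x y) x y := by
  refine ⟨fun t => AffineMap.lineMap x y (t : ℝ), ?_, ?_, by simp, by simp, ?_⟩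
  · have : Continuous (AffineMap.lineMap x y : ℝ → ℝ × ℝ) := AffineMap.lineMap_continuous
    exact this.comp continuous_subtype_val
  · exact (AffineMap.lineMap_injective ℝ h).comp Subtype.val_injective
  · rw [segment_eq_image_lineMap]
    ext z
    simp

/-- Two arcs ending on a convex set, joined by a segment. -/
lemma IsArc.join {K : Set (ℝ × ℝ)} {a b : ℝ × ℝ} (hK : Convex ℝ K)
    (hA : IsArc A a x) (hB : IsArc B b y) (hAK : A ∩ K = {a}) (hBK : B ∩ K = {b})
    (hAB : Disjoint A B) : IsArc (A ∪ segment ℝ a b ∪ B) x y := by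
  have ha : a ∈ K := (hAK.ge rfl).2
  have hb : b ∈ K := (hBK.ge rfl).2
  have hab : a ≠ b := fun h => Set.disjoint_left.1 hAB hA.left_mem (h ▸ hB.left_mem)
  have hs := hK.segment_subset ha hb
  refine (hA.symm.concat (isArc_segment hab) ?_).concat hB ?_
  · exact fun z hz => hAK.le ⟨hz.1, hs hz.2⟩
  · rintro z ⟨hz | hz, hzB⟩
    · exact absurd hzB (Set.disjoint_left.1 hAB hz)
    · exact hBK.le ⟨hzB, hs hz⟩

end Arc

/-! ### Chords of a circle -/

/-- The closed Euclidean disc of radius `ρ` around `c`. -/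
def disc (c : ℝ × ℝ) (ρ : ℝ) : Set (ℝ × ℝ) := {z | (z.1 - c.1) ^ 2 + (z.2 - c.2) ^ 2 ≤ ρ ^ 2}

/-- The Euclidean circle of radius `ρ` around `c`. -/
def circ (c : ℝ × ℝ) (ρ : ℝ) : Set (ℝ × ℝ) := {z | (z.1 - c.1) ^ 2 + (z.2 - c.2) ^ 2 = ρ ^ 2}

lemma isClosed_disc (c : ℝ × ℝ) (ρ : ℝ) : IsClosed (disc c ρ) :=
  isClosed_le (by fun_prop) (by fun_prop)

lemma center_mem_disc (c : ℝ × ℝ) (ρ : ℝ) : c ∈ disc c ρ := by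
  simp [disc, sq_nonneg]

lemma convex_disc (c : ℝ × ℝ) (ρ : ℝ) : Convex ℝ (disc c ρ) := by
  rintro ⟨a₁, a₂⟩ ha ⟨b₁, b₂⟩ hb s t hs ht hst
  simp only [disc, Set.mem_ofPred_eq, Prod.smul_mk, Prod.mk_add_mk, smul_eq_mul] at *
  obtain rfl : t = 1 - s := by linarith
  have : (s * a₁ + (1 - s) * b₁ - c.1) ^ 2 + (s * a₂ + (1 - s) * b₂ - c.2) ^ 2 =
      s * ((a₁ - c.1) ^ 2 + (a₂ - c.2) ^ 2) + (1 - s) * ((b₁ - c.1) ^ 2 + (b₂ - c.2) ^ 2)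
      - s * (1 - s) * ((a₁ - b₁) ^ 2 + (a₂ - b₂) ^ 2) := by ring
  have h1 := mul_le_mul_of_nonneg_left ha hs
  have h2 := mul_le_mul_of_nonneg_left hb ht
  have h3 : 0 ≤ s * (1 - s) * ((a₁ - b₁) ^ 2 + (a₂ - b₂) ^ 2) := by positivity
  linarith

lemma mem_circ_of_mem_closure {c z : ℝ × ℝ} {ρ : ℝ} (h : z ∈ disc c ρ)
    (h' : z ∈ closure (disc c ρ)ᶜ) : z ∈ circ c ρ := by
  refine le_antisymm h ?_
  have hc : IsClosed {z : ℝ × ℝ | ρ ^ 2 ≤ (z.1 - c.1) ^ 2 + (z.2 - c.2) ^ 2} :=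
    isClosed_le (by fun_prop) (by fun_prop)
  refine closure_minimal ?_ hc h'
  intro w hw
  simp only [disc, Set.mem_compl_iff, Set.mem_ofPred_eq, not_le] at hw
  exact hw.le

lemma exists_disc_subset {c : ℝ × ℝ} {Z : Set (ℝ × ℝ)} (hZ : IsClosed Z) (hc : c ∉ Z) :
    ∃ ρ > 0, Disjoint (disc c ρ) Z := by
  obtain ⟨ε, hε, h⟩ := Metric.isOpen_iff.1 hZ.isOpen_compl c hc
  refine ⟨ε / 2, by positivity, Set.disjoint_left.2 fun z hz => h ?_⟩
  simp only [disc, Set.mem_ofPred_eq] at hz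
  rw [Metric.mem_ball, Prod.dist_eq, Real.dist_eq, Real.dist_eq]
  refine lt_of_le_of_lt (max_le (b := |z.2 - c.2|) (c := ε / 2) ?_ ?_) (by linarith)
  · exact abs_le_of_sq_le_sq (by nlinarith [sq_nonneg (z.2 - c.2)]) (by positivity)
  · exact abs_le_of_sq_le_sq (by nlinarith [sq_nonneg (z.1 - c.1)]) (by positivity)

/-- Three distinct points of a circle are affinely independent. -/
lemma circ_independent {o b c d : ℝ × ℝ} {ρ β γ δ : ℝ} (hb : b ∈ circ o ρ) (hc : c ∈ circ o ρ)
    (hd : d ∈ circ o ρ) (hbc : b ≠ c) (hbd : b ≠ d) (hcd : c ≠ d)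
    (h : β • b = γ • c + δ • d) (hsum : β = γ + δ) : γ = 0 ∧ δ = 0 := by
  have hsq : ∀ {p q : ℝ × ℝ}, p ≠ q → (p.1 - q.1) ^ 2 + (p.2 - q.2) ^ 2 ≠ 0 := by
    intro p q hpq h0
    apply hpq
    ext <;> nlinarith [sq_nonneg (p.1 - q.1), sq_nonneg (p.2 - q.2)]
  have h1 : β * b.1 = γ * c.1 + δ * d.1 := by simpa using congrArg Prod.fst h
  have h2 : β * b.2 = γ * c.2 + δ * d.2 := by simpa using congrArg Prod.snd h
  simp only [circ, Set.mem_ofPred_eq] at hb hc hd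
  have e1 : β * (b.1 - o.1) = γ * (c.1 - o.1) + δ * (d.1 - o.1) := by
    rw [hsum] at h1 ⊢; linarith
  have e2 : β * (b.2 - o.2) = γ * (c.2 - o.2) + δ * (d.2 - o.2) := by
    rw [hsum] at h2 ⊢; linarith
  have key : γ * δ * ((c.1 - d.1) ^ 2 + (c.2 - d.2) ^ 2) = 0 := by
    have e3 : (β * (b.1 - o.1)) ^ 2 + (β * (b.2 - o.2)) ^ 2 = (γ + δ) ^ 2 * ρ ^ 2 := by
      rw [← hb, hsum]; ring
    rw [e1, e2] at e3
    linear_combination (γ ^ 2 + γ * δ) * hc + (δ ^ 2 + γ * δ) * hd - e3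
  rcases mul_eq_zero.1 key with h0 | h0
  · rcases mul_eq_zero.1 h0 with rfl | rfl
    · refine ⟨rfl, ?_⟩
      have : δ ^ 2 * ((b.1 - d.1) ^ 2 + (b.2 - d.2) ^ 2) = 0 := by
        rw [zero_add] at hsum
        subst hsum
        linear_combination (β * b.1 - β * d.1) * h1 + (β * b.2 - β * d.2) * h2
      simpa using (mul_eq_zero.1 this).resolve_right (hsq hbd)
    · refine ⟨?_, rfl⟩
      have : γ ^ 2 * ((b.1 - c.1) ^ 2 + (b.2 - c.2) ^ 2) = 0 := by
        rw [add_zero] at hsum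
        subst hsum
        linear_combination (β * b.1 - β * c.1) * h1 + (β * b.2 - β * c.2) * h2
      simpa using (mul_eq_zero.1 this).resolve_right (hsq hbc)
  · exact absurd h0 (hsq hcd)

/-- Among two of the pairings of four points of a circle, one consists of disjoint chords. -/
lemma disjoint_chords {o a b c d : ℝ × ℝ} {ρ : ℝ} (hb : b ∈ circ o ρ)
    (hc : c ∈ circ o ρ) (hd : d ∈ circ o ρ) (hbc : b ≠ c) (hbd : b ≠ d) (hcd : c ≠ d)
    (had : a ≠ d) :
    Disjoint (segment ℝ a b) (segment ℝ c d) ∨ Disjoint (segment ℝ a c) (segment ℝ b d) := by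
  by_contra! hcon
  obtain ⟨h1, h2⟩ := hcon
  obtain ⟨z, ⟨t, t₁, ht, ht₁, htt, rfl⟩, ⟨s, s₁, hs, hs₁, hss, h1⟩⟩ := Set.not_disjoint_iff.1 h1
  obtain ⟨z, ⟨t', t₁', ht', ht₁', htt', rfl⟩, ⟨s', s₁', hs', hs₁', hss', h2⟩⟩ :=
    Set.not_disjoint_iff.1 h2
  obtain rfl : t₁ = 1 - t := by linarith
  obtain rfl : s₁ = 1 - s := by linarith
  obtain rfl : t₁' = 1 - t' := by linarith
  obtain rfl : s₁' = 1 - s' := by linarith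
  have rel : (t' * (1 - t) + t * s') • b =
      (t * (1 - t') + t' * s) • c + (t' * (1 - s) - t * (1 - s')) • d := by
    linear_combination (norm := module) t • h2 - t' • h1
  obtain ⟨hC, hD⟩ := circ_independent hb hc hd hbc hbd hcd rel (by ring)
  have hB : t' * (1 - t) + t * s' = 0 := by linarith
  have b1 : t' * (1 - t) = 0 := by nlinarith [mul_nonneg ht' ht₁, mul_nonneg ht hs']
  have b2 : t * s' = 0 := by nlinarith [mul_nonneg ht' ht₁, mul_nonneg ht hs']
  have c1 : t * (1 - t') = 0 := by nlinarith [mul_nonneg ht ht₁', mul_nonneg ht' hs]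
  rcases mul_eq_zero.1 b2 with rfl | rfl
  · have ht'0 : t' = 0 := by linarith
    have := circ_independent hb hc hd hbc hbd hcd (β := 1) (γ := s) (δ := 1 - s)
      (by rw [h1]; simp) (by ring)
    linarith [this.1, this.2]
  · rcases mul_eq_zero.1 c1 with rfl | h0
    · have ht'0 : t' = 0 := by linarith
      have := circ_independent hb hc hd hbc hbd hcd (β := 1) (γ := s) (δ := 1 - s)
        (by rw [h1]; simp) (by ring)
      linarith [this.1, this.2]
    · obtain rfl : t' = 1 := by linarith
      exact had (by simpa using h2.symm)

/-! ### Crossings of a drawing -/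

section Crossings

variable {V : Type*} {G : SimpleGraph V} {D : Drawing G} {S : Set CrossingType}

lemma Drawing.Crosses.symm {e e' : Sym2 V} {p : ℝ × ℝ} (h : D.Crosses e e' p) :
    D.Crosses e' e p :=
  ⟨h.2.1, h.1, h.2.2.1.symm, h.2.2.2.2.1, h.2.2.2.1, h.2.2.2.2.2⟩

lemma Drawing.isArc (D : Drawing G) {u v : V} (h : G.Adj u v) :
    IsArc (D.arc s(u, v)) (D.pos u) (D.pos v) :=
  D.arc_curve _ h _ _ rfl

/-- Two edges meet in a common endpoint or in a crossing. -/
lemma Drawing.mem_arc_inter (D : Drawing G) {e f : Sym2 V} (he : e ∈ G.edgeSet)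
    (hf : f ∈ G.edgeSet) (hne : e ≠ f) {q : ℝ × ℝ} (hq : q ∈ D.arc e) (hq' : q ∈ D.arc f) :
    (∃ w, q = D.pos w ∧ w ∈ e ∧ w ∈ f) ∨ D.Crosses e f q := by
  by_cases h : q ∈ Set.range D.pos
  · obtain ⟨w, rfl⟩ := h
    exact .inl ⟨w, rfl, D.arc_avoid e he w hq, D.arc_avoid f hf w hq'⟩
  · exact .inr ⟨he, hf, hne, hq, hq', h⟩

lemma Drawing.IsOnePlanar.mem_arc_inter_of_crosses (hD : D.IsOnePlanar) {e e' f : Sym2 V}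
    {p q : ℝ × ℝ} (hc : D.Crosses e e' p) (hf : f ∈ G.edgeSet) (hne : e ≠ f) (hne' : e' ≠ f)
    (hq : q ∈ D.arc e) (hq' : q ∈ D.arc f) : ∃ w, q = D.pos w ∧ w ∈ e ∧ w ∈ f :=
  (D.mem_arc_inter hc.1 hf hne hq hq').resolve_right fun h =>
    hne' (hD.1 _ _ _ _ _ hc h).1

lemma Drawing.IsOnePlanar.mem_arc_inter_of_adj (hD : D.IsOnePlanar) {u v w : V}
    (hv : G.Adj u v) (hw : G.Adj u w) (hne : v ≠ w) {q : ℝ × ℝ}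
    (hq : q ∈ D.arc s(u, v)) (hq' : q ∈ D.arc s(u, w)) : q = D.pos u := by
  have hne' : s(u, v) ≠ s(u, w) := fun h => hne (Sym2.congr_right.1 h)
  rcases D.mem_arc_inter hv hw hne' hq hq' with ⟨z, rfl, h1, h2⟩ | h
  · rw [Sym2.mem_iff] at h1 h2
    rcases h1 with rfl | rfl
    · rfl
    · rcases h2 with rfl | h2
      · rfl
      · exact absurd h2 hne
  · exact absurd (Sym2.mem_mk_left u w) (hD.2 _ _ _ h u (Sym2.mem_mk_left u v))

lemma Drawing.IsOnePlanar.eq_of_mem_arcs (hD : D.IsOnePlanar) {e e' : Sym2 V}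
    {p q : ℝ × ℝ} (hc : D.Crosses e e' p) (hq : q ∈ D.arc e) (hq' : q ∈ D.arc e') : q = p := by
  rcases D.mem_arc_inter hc.1 hc.2.1 hc.2.2.1 hq hq' with ⟨w, -, h1, h2⟩ | h
  · exact absurd h2 (hD.2 _ _ _ hc w h1)
  · exact (hD.1 _ _ _ _ _ h hc).2

lemma Drawing.Crosses.split {u x : V} {e : Sym2 V} {p : ℝ × ℝ} (h : D.Crosses s(u, x) e p) :
    ∃ A₁ A₂, IsArc A₁ (D.pos u) p ∧ IsArc A₂ p (D.pos x) ∧ A₁ ∪ A₂ = D.arc s(u, x) ∧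
      A₁ ∩ A₂ = {p} :=
  (D.isArc h.1).split h.2.2.2.1 (fun h' => h.2.2.2.2.2 ⟨u, h'.symm⟩)
    (fun h' => h.2.2.2.2.2 ⟨x, h'.symm⟩)

/-- The half of a crossed edge between an endpoint and the crossing. -/
lemma Drawing.Crosses.exists_half {u x : V} {e : Sym2 V} {p : ℝ × ℝ}
    (h : D.Crosses s(u, x) e p) :
    ∃ A ⊆ D.arc s(u, x), IsArc A (D.pos u) p ∧ ∀ w, D.pos w ∈ A → w = u := by
  obtain ⟨A₁, A₂, h1, h2, hu, hi⟩ := h.split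
  refine ⟨A₁, hu ▸ Set.subset_union_left, h1, fun w hw => ?_⟩
  have hw' : D.pos w ∈ D.arc s(u, x) := hu ▸ Or.inl hw
  rcases Sym2.mem_iff.1 (D.arc_avoid _ h.1 w hw') with rfl | rfl
  · rfl
  · exact absurd ⟨w, hi.le ⟨hw, h2.right_mem⟩⟩ h.2.2.2.2.2

/-- The ordered pairs of crossing edges. -/
def Drawing.crossSet (D : Drawing G) : Set (Sym2 V × Sym2 V) :=
  {q | ∃ p, D.Crosses q.1 q.2 p}

/-- A drawing whose crossings inject into those of an `S`-restricted drawing, missing at least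
one of them, has fewer crossings. -/
lemma Drawing.IsSRestricted.transfer [Finite V] (hD : D.IsSRestricted S) (D' : Drawing G)
    (φ : Sym2 V → Sym2 V) (C : Set (Sym2 V)) (hinj : Set.InjOn φ C)
    (hC : ∀ e e' p, D'.Crosses e e' p → e ∈ C ∧ e' ∈ C ∧ D.Crosses (φ e) (φ e') p)
    (hadj : ∀ e e' p, D'.Crosses e e' p → ∀ v ∈ e, v ∉ e')
    (htype : ∀ a b c d p, D'.Crosses s(a, b) s(c, d) p → ∃ t ∈ S, HasCrossingType G a b c d t)
    {e₀ e₁ : Sym2 V} {p₀ : ℝ × ℝ} (h₀ : D.Crosses e₀ e₁ p₀)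
    (hmiss : ∀ e e' p, D'.Crosses e e' p → φ e ≠ e₀ ∨ φ e' ≠ e₁) :
    D'.IsSRestricted S ∧ D'.crossSet.ncard < D.crossSet.ncard := by
  refine ⟨⟨⟨?_, hadj⟩, htype⟩, ?_⟩
  · intro e e₁ e₂ p q h1 h2
    obtain ⟨-, c1, h1⟩ := hC _ _ _ h1
    obtain ⟨-, c2, h2⟩ := hC _ _ _ h2
    obtain ⟨h3, h4⟩ := hD.1.1 _ _ _ _ _ h1 h2
    exact ⟨hinj c1 c2 h3, h4⟩
  · have hinj' : Set.InjOn (Prod.map φ φ) D'.crossSet := by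
      rintro ⟨e, e'⟩ ⟨p, hp⟩ ⟨f, f'⟩ ⟨q, hq⟩ h
      obtain ⟨c1, c2, -⟩ := hC _ _ _ hp
      obtain ⟨c3, c4, -⟩ := hC _ _ _ hq
      simp only [Prod.map_apply, Prod.mk.injEq] at h
      exact Prod.ext (hinj c1 c3 h.1) (hinj c2 c4 h.2)
    rw [← hinj'.ncard_image]
    refine Set.ncard_lt_ncard ⟨?_, fun h => ?_⟩ (Set.toFinite _)
    · rintro _ ⟨⟨e, e'⟩, ⟨p, hp⟩, rfl⟩
      exact ⟨p, (hC _ _ _ hp).2.2⟩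
    · obtain ⟨⟨e, e'⟩, ⟨p, hp⟩, h⟩ := @h (e₀, e₁) ⟨p₀, h₀⟩
      simp only [Prod.map_apply, Prod.mk.injEq] at h
      rcases hmiss _ _ _ hp with h' | h'
      · exact h' h.1
      · exact h' h.2

/-! ### Three crossings around a separating pair -/

/-- Three crossings between edges at `u` and edges at `v` cannot have endpoints in a common
component of `G - {u, v}`. -/
lemma Drawing.IsOnePlanar.not_three_crossings (hD : D.IsOnePlanar) {u v : V} (huv : u ≠ v)
    {x y z : Fin 3 → V} {p : Fin 3 → ℝ × ℝ} (hc : ∀ i, D.Crosses s(u, x i) s(v, y i) (p i))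
    (hinj : Function.Injective x) (hz : ∀ i, z i = x i ∨ z i = y i)
    (hzm : ∀ i, z i ∈ ({u, v} : Set V)ᶜ)
    (hreach : ∀ i, (G.induce ({u, v} : Set V)ᶜ).Reachable ⟨z 0, hzm 0⟩ ⟨z i, hzm i⟩) : False := by
  have hu : ∀ i, y i ≠ u := fun i h =>
    hD.2 _ _ _ (hc i) u (Sym2.mem_mk_left _ _) (h ▸ Sym2.mem_mk_right _ _)
  have hv : ∀ i, x i ≠ v := fun i h =>
    hD.2 _ _ _ (hc i).symm v (Sym2.mem_mk_left _ _) (h ▸ Sym2.mem_mk_right _ _)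
  have hxx : ∀ i j, i ≠ j → s(u, x i) ≠ s(u, x j) := fun i j hij h =>
    hij (hinj (Sym2.congr_right.1 h))
  have hyy : ∀ i j, i ≠ j → s(v, y i) ≠ s(v, y j) := fun i j hij h =>
    hxx i j hij (hD.1 _ _ _ _ _ (hc i).symm (h ▸ (hc j).symm)).1
  have hxy : ∀ i j, s(u, x i) ≠ s(v, y j) := fun i j h => by
    have : u ∈ s(v, y j) := h ▸ Sym2.mem_mk_left _ _
    rcases Sym2.mem_iff.1 this with h | h
    · exact huv h
    · exact hu j h.symm
  choose U hUs hU hUv using fun i => (hc i).exists_half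
  choose W hWs hW hWv using fun i => (hc i).symm.exists_half
  have hZ : ∀ i, ∃ A, IsArc A (D.pos (z i)) (p i) ∧ (∀ w, D.pos w ∈ A → w = z i) ∧
      (A ⊆ D.arc s(u, x i) ∨ A ⊆ D.arc s(v, y i)) := by
    intro i
    rcases hz i with h | h
    · have h' : D.Crosses s(x i, u) s(v, y i) (p i) := Sym2.eq_swap (a := u) ▸ hc i
      obtain ⟨A, h1, h2, h3⟩ := h'.exists_half
      exact ⟨A, h ▸ h2, h ▸ h3, .inl (Sym2.eq_swap (a := u) ▸ h1)⟩
    · have h' : D.Crosses s(y i, v) s(u, x i) (p i) := Sym2.eq_swap (a := v) ▸ (hc i).symm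
      obtain ⟨A, h1, h2, h3⟩ := h'.exists_half
      exact ⟨A, h ▸ h2, h ▸ h3, .inr (Sym2.eq_swap (a := v) ▸ h1)⟩
  choose Z hZ hZv hZs using hZ
  let K : Set (ℝ × ℝ) := {q | (∃ w, w ≠ u ∧ w ≠ v ∧ q = D.pos w) ∨
    ∃ f ∈ G.edgeSet, u ∉ f ∧ v ∉ f ∧ q ∈ D.arc f}
  have hzu : ∀ i, z i ≠ u := fun i h => hzm i (.inl h)
  have hzv : ∀ i, z i ≠ v := fun i h => hzm i (.inr h)
  have hK : ∀ i, JoinedIn K (D.pos (z 0)) (D.pos (z i)) := by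
    intro i
    have walk : ∀ a b : (({u, v} : Set V)ᶜ : Set V),
        (G.induce ({u, v} : Set V)ᶜ).Walk a b → JoinedIn K (D.pos a) (D.pos b) := by
      intro a b w
      induction w with
      | nil =>
        rename_i a
        exact JoinedIn.refl (.inl ⟨a, fun h => a.2 (.inl h), fun h => a.2 (.inr h), rfl⟩)
      | cons h _ ih =>
        rename_i a b c w
        refine JoinedIn.trans ((D.isArc (u := a) (v := b) h).joinedIn.mono ?_) ih
        intro q hq
        refine .inr ⟨_, h, ?_, ?_, hq⟩ <;> rw [Sym2.mem_iff] <;> rintro (h | h)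
        · exact a.2 (.inl h.symm)
        · exact b.2 (.inl h.symm)
        · exact a.2 (.inr h.symm)
        · exact b.2 (.inr h.symm)
    obtain ⟨w⟩ := hreach i
    exact walk _ _ w
  have hUW : ∀ i j, i ≠ j → Disjoint (U i) (W j) := by
    refine fun i j hij => Set.disjoint_left.2 fun q h1 h2 => ?_
    obtain ⟨w, rfl, -, -⟩ := hD.mem_arc_inter_of_crosses (hc i) (hc j).2.1 (hxy i j)
      (hyy i j hij) (hUs i h1) (hWs j h2)
    exact huv ((hUv i w h1).symm.trans (hWv j w h2))
  have hUK : ∀ i j, i ≠ j → Disjoint (U i) (K ∪ Z j) := by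
    refine fun i j hij => Set.disjoint_left.2 fun q h1 h2 => ?_
    rcases h2 with (⟨w, hw, -, rfl⟩ | ⟨f, hf, hfu, hfv, hq⟩) | h2
    · exact hw (hUv i w h1)
    · obtain ⟨w, rfl, -, hw⟩ := hD.mem_arc_inter_of_crosses (hc i) hf
        (fun h => hfu (h ▸ Sym2.mem_mk_left _ _)) (fun h => hfv (h ▸ Sym2.mem_mk_left _ _))
        (hUs i h1) hq
      exact hfu (hUv i w h1 ▸ hw)
    · have : ∃ w, q = D.pos w := by
        rcases hZs j with h | h
        · obtain ⟨w, h, -, -⟩ := hD.mem_arc_inter_of_crosses (hc i) (hc j).1 (hxx i j hij)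
            (hxy j i).symm (hUs i h1) (h h2)
          exact ⟨w, h⟩
        · obtain ⟨w, h, -, -⟩ := hD.mem_arc_inter_of_crosses (hc i) (hc j).2.1 (hxy i j)
            (hyy i j hij) (hUs i h1) (h h2)
          exact ⟨w, h⟩
      obtain ⟨w, rfl⟩ := this
      exact hzu j ((hZv j w h2).symm.trans (hUv i w h1))
  have hWK : ∀ i j, i ≠ j → Disjoint (W i) (K ∪ Z j) := by
    refine fun i j hij => Set.disjoint_left.2 fun q h1 h2 => ?_
    rcases h2 with (⟨w, -, hw, rfl⟩ | ⟨f, hf, hfu, hfv, hq⟩) | h2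
    · exact hw (hWv i w h1)
    · obtain ⟨w, rfl, -, hw⟩ := hD.mem_arc_inter_of_crosses (hc i).symm hf
        (fun h => hfv (h ▸ Sym2.mem_mk_left _ _)) (fun h => hfu (h ▸ Sym2.mem_mk_left _ _))
        (hWs i h1) hq
      exact hfv (hWv i w h1 ▸ hw)
    · have : ∃ w, q = D.pos w := by
        rcases hZs j with h | h
        · obtain ⟨w, h, -, -⟩ := hD.mem_arc_inter_of_crosses (hc i).symm (hc j).1
            (hxy j i).symm (hxx i j hij) (hWs i h1) (h h2)
          exact ⟨w, h⟩
        · obtain ⟨w, h, -, -⟩ := hD.mem_arc_inter_of_crosses (hc i).symm (hc j).2.1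
            (hyy i j hij) (hxy i j) (hWs i h1) (h h2)
          exact ⟨w, h⟩
      obtain ⟨w, rfl⟩ := this
      exact hzv j ((hZv j w h2).symm.trans (hWv i w h1))
  refine not_planar_K33_joinedIn (l := ![D.pos u, D.pos v, D.pos (z 0)]) (r := p)
    (Γ := ![U, W, fun i => K ∪ Z i]) ?_ ?_
  · intro i j
    fin_cases i
    · exact (hU j).joinedIn
    · exact (hW j).joinedIn
    · exact ((hK j).mono Set.subset_union_left).trans
        ((hZ j).joinedIn.mono Set.subset_union_right)
  · intro i i' j j' hi hj
    fin_cases i <;> fin_cases i' <;> first | exact absurd rfl hi | skip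
    · exact hUW j j' hj
    · exact hUK j j' hj
    · exact (hUW j' j hj.symm).symm
    · exact hWK j j' hj
    · exact (hUK j' j hj.symm).symm
    · exact (hWK j' j hj.symm).symm

end Crossings

/-! ### Crossings of edges at twin vertices of degree two -/

section Twins

variable {V : Type*} {G : SimpleGraph V} {D : Drawing G} {S : Set CrossingType}

lemma HasCrossingType.congr {a b c d a' b' c' d' : V} {t : CrossingType}
    (h : HasCrossingType G a b c d t) (h₁ : G.Adj a c ↔ G.Adj a' c')
    (h₂ : G.Adj a d ↔ G.Adj a' d') (h₃ : G.Adj b c ↔ G.Adj b' c')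
    (h₄ : G.Adj b d ↔ G.Adj b' d') : HasCrossingType G a' b' c' d' t := by
  cases t <;> simpa only [HasCrossingType, h₁, h₂, h₃, h₄] using h

lemma HasCrossingType.swap {a b c d : V} {t : CrossingType}
    (h : HasCrossingType G a b c d t) : HasCrossingType G c d a b t := by
  cases t <;> simp only [HasCrossingType, G.adj_comm c, G.adj_comm d] at h ⊢ <;> tauto

lemma IsArc.of_sym2_eq {A : Set (ℝ × ℝ)} {pos : V → ℝ × ℝ} {u v u' v' : V}
    (h : IsArc A (pos u) (pos v)) (he : s(u, v) = s(u', v')) : IsArc A (pos u') (pos v') := by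
  rcases Sym2.eq_iff.1 he with ⟨rfl, rfl⟩ | ⟨rfl, rfl⟩
  · exact h
  · exact h.symm

/-- The edges `ux` and `vy` cross, and both `x` and `y` have exactly the neighbours `u`, `v`. -/
structure Drawing.IsTwinCrossing (D : Drawing G) (u v x y : V) (c : ℝ × ℝ) : Prop where
  ne : u ≠ v
  ne' : x ≠ y
  adj_left : ∀ w, G.Adj x w ↔ w = u ∨ w = v
  adj_right : ∀ w, G.Adj y w ↔ w = u ∨ w = v
  crosses : D.Crosses s(u, x) s(v, y) c

namespace Drawing.IsTwinCrossing

variable {u v x y : V} {c : ℝ × ℝ}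

lemma ux (h : D.IsTwinCrossing u v x y c) : G.Adj u x := h.crosses.1

lemma vy (h : D.IsTwinCrossing u v x y c) : G.Adj v y := h.crosses.2.1

lemma vx (h : D.IsTwinCrossing u v x y c) : G.Adj v x := ((h.adj_left v).2 (.inr rfl)).symm

lemma uy (h : D.IsTwinCrossing u v x y c) : G.Adj u y := ((h.adj_right u).2 (.inl rfl)).symm

lemma edge_cases (h : D.IsTwinCrossing u v x y c) {e : Sym2 V} (he : e ∈ G.edgeSet) :
    e = s(u, x) ∨ e = s(v, x) ∨ e = s(u, y) ∨ e = s(v, y) ∨ x ∉ e ∧ y ∉ e := by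
  by_cases hx : x ∈ e
  · obtain ⟨w, rfl⟩ := hx
    rcases (h.adj_left w).1 he with rfl | rfl
    · exact .inl Sym2.eq_swap
    · exact .inr (.inl Sym2.eq_swap)
  by_cases hy : y ∈ e
  · obtain ⟨w, rfl⟩ := hy
    rcases (h.adj_right w).1 he with rfl | rfl
    · exact .inr (.inr (.inl Sym2.eq_swap))
    · exact .inr (.inr (.inr (.inl Sym2.eq_swap)))
  · exact .inr (.inr (.inr (.inr ⟨hx, hy⟩)))

/-- Redrawing the paths `u x v` and `u y v` along new curves: if the new curves are disjoint and
meet the rest of the drawing only where `uy` and `vx` do, then a crossing disappears. -/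
lemma reroute [Finite V] (h : D.IsTwinCrossing u v x y c) (hD : D.IsSRestricted S)
    {a b : ℝ × ℝ} {A₁ A₂ B₁ B₂ : Set (ℝ × ℝ)}
    (hA₁ : IsArc A₁ (D.pos u) a) (hA₂ : IsArc A₂ a (D.pos v))
    (hB₁ : IsArc B₁ (D.pos u) b) (hB₂ : IsArc B₂ b (D.pos v))
    (hA : A₁ ∩ A₂ ⊆ {a}) (hB : B₁ ∩ B₂ ⊆ {b})
    (hAB : (A₁ ∪ A₂) ∩ (B₁ ∪ B₂) ⊆ {D.pos u, D.pos v})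
    (hpos : ∀ w, w ≠ x → w ≠ y → D.pos w ∈ A₁ ∪ A₂ ∪ (B₁ ∪ B₂) → w = u ∨ w = v)
    (hfA : ∀ f ∈ G.edgeSet, x ∉ f → y ∉ f → D.arc f ∩ (A₁ ∪ A₂) ⊆ {D.pos u, D.pos v})
    (hfB₁ : ∀ f ∈ G.edgeSet, x ∉ f → y ∉ f →
      D.arc f ∩ B₁ ⊆ D.arc s(u, y) ∪ {D.pos u, D.pos v})
    (hfB₂ : ∀ f ∈ G.edgeSet, x ∉ f → y ∉ f →
      D.arc f ∩ B₂ ⊆ D.arc s(v, x) ∪ {D.pos u, D.pos v})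
    (hfb : ∀ f ∈ G.edgeSet, x ∉ f → y ∉ f → b ∉ D.arc f) :
    ∃ D' : Drawing G, D'.IsSRestricted S ∧ D'.crossSet.ncard < D.crossSet.ncard := by
  classical
  have hux := h.ux.ne
  have huy := h.uy.ne
  have hvx := h.vx.ne
  have hvy := h.vy.ne
  have huv := h.ne
  have hxy := h.ne'
  obtain ⟨pos', px, py, pw⟩ : ∃ pos' : V → ℝ × ℝ, pos' x = b ∧ pos' y = a ∧
      ∀ w, w ≠ x → w ≠ y → pos' w = D.pos w :=
    ⟨Function.update (Function.update D.pos x b) y a, by simp [hxy], by simp,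
      fun w h1 h2 => by simp [h1, h2]⟩
  have pu := pw u hux huy
  have pv := pw v hvx hvy
  have e₁ : s(v, x) ≠ s(u, x) := by simp [huv.symm, hvx]
  have e₂ : s(u, y) ≠ s(u, x) := by simp [huy.symm, hxy.symm, hux]
  have e₃ : s(u, y) ≠ s(v, x) := by simp [huv, hux]
  have e₄ : s(v, y) ≠ s(u, x) := by simp [huv.symm, hvx]
  have e₅ : s(v, y) ≠ s(v, x) := by simp [hxy.symm, hvx]
  have e₆ : s(v, y) ≠ s(u, y) := by simp [huv.symm, hvy]
  obtain ⟨arc', q1, q2, q3, q4, q5⟩ : ∃ arc' : Sym2 V → Set (ℝ × ℝ), arc' s(u, x) = B₁ ∧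
      arc' s(v, x) = B₂ ∧ arc' s(u, y) = A₁ ∧ arc' s(v, y) = A₂ ∧
      ∀ f, x ∉ f → y ∉ f → arc' f = D.arc f := by
    refine ⟨fun e => if e = s(u, x) then B₁ else if e = s(v, x) then B₂ else
      if e = s(u, y) then A₁ else if e = s(v, y) then A₂ else D.arc e, if_pos rfl, ?_, ?_, ?_, ?_⟩
    · simp only [if_neg e₁, if_true]
    · simp only [if_neg e₂, if_neg e₃, if_true]
    · simp only [if_neg e₄, if_neg e₅, if_neg e₆, if_true]
    · intro f hx hy
      have : ∀ w, f ≠ s(w, x) ∧ f ≠ s(w, y) := fun w =>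
        ⟨fun h' => hx (h' ▸ Sym2.mem_mk_right _ _), fun h' => hy (h' ▸ Sym2.mem_mk_right _ _)⟩
      simp only [(this u).1, (this u).2, (this v).1, (this v).2, if_false]
  have hau : a ≠ D.pos u := hA₁.ne.symm
  have hav : a ≠ D.pos v := hA₂.ne
  have hbu : b ≠ D.pos u := hB₁.ne.symm
  have hbv : b ≠ D.pos v := hB₂.ne
  have ha₁ := hA₁.right_mem
  have ha₂ := hA₂.left_mem
  have hb₁ := hB₁.right_mem
  have hb₂ := hB₂.left_mem
  have haB : a ∉ B₁ ∪ B₂ := fun h' => (hAB ⟨.inl ha₁, h'⟩).elim hau hav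
  have hbA : b ∉ A₁ ∪ A₂ := fun h' => (hAB ⟨h', .inl hb₁⟩).elim hbu hbv
  have huA : D.pos u ∉ A₂ := fun h' => hau (hA ⟨hA₁.left_mem, h'⟩).symm
  have hvA : D.pos v ∉ A₁ := fun h' => hav (hA ⟨h', hA₂.right_mem⟩).symm
  have huB : D.pos u ∉ B₂ := fun h' => hbu (hB ⟨hB₁.left_mem, h'⟩).symm
  have hvB : D.pos v ∉ B₁ := fun h' => hbv (hB ⟨h', hB₂.right_mem⟩).symm
  have hab : a ≠ b := fun h' => haB (h' ▸ .inl hb₁)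
  have hpa : ∀ w, w ≠ x → w ≠ y → D.pos w ≠ a := by
    rintro w h1 h2 rfl
    rcases hpos w h1 h2 (.inl (.inl ha₁)) with rfl | rfl
    · exact hau rfl
    · exact hav rfl
  have hpb : ∀ w, w ≠ x → w ≠ y → D.pos w ≠ b := by
    rintro w h1 h2 rfl
    rcases hpos w h1 h2 (.inr (.inl hb₁)) with rfl | rfl
    · exact hbu rfl
    · exact hbv rfl
  have hru : D.pos u ∈ Set.range pos' := ⟨u, pu⟩
  have hrv : D.pos v ∈ Set.range pos' := ⟨v, pv⟩
  have hruv : ∀ q ∈ ({D.pos u, D.pos v} : Set (ℝ × ℝ)), q ∈ Set.range pos' := by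
    rintro q (rfl | rfl)
    exacts [hru, hrv]
  let C : Set (Sym2 V) := {e | e ≠ s(u, y) ∧ e ≠ s(v, y)}
  let φ : Sym2 V → Sym2 V := fun e => if e = s(u, x) then s(u, y) else e
  have hφ : φ s(u, x) = s(u, y) := if_pos rfl
  have hφ' : ∀ {e}, e ≠ s(u, x) → φ e = e := fun h => if_neg h
  have old : ∀ f ∈ G.edgeSet, x ∉ f → y ∉ f → f ∈ C ∧ φ f = f := fun f _ h1 h2 =>
    ⟨⟨fun h => h2 (h ▸ Sym2.mem_mk_right _ _), fun h => h2 (h ▸ Sym2.mem_mk_right _ _)⟩,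
      hφ' fun h => h1 (h ▸ Sym2.mem_mk_right _ _)⟩
  have hold : ∀ e ∈ G.edgeSet, ∀ f ∈ G.edgeSet, x ∉ f → y ∉ f → e ≠ f → ∀ q ∈ D.arc e,
      q ∈ D.arc f → q ∈ Set.range pos' ∨ D.Crosses e f q := by
    intro e he f hf hx hy hne q hq hq'
    rcases D.mem_arc_inter he hf hne hq hq' with ⟨w, rfl, -, hw⟩ | h'
    · exact .inl ⟨w, pw w (fun h => hx (h ▸ hw)) (fun h => hy (h ▸ hw))⟩
    · exact .inr h'
  have key₁ : ∀ e ∈ G.edgeSet, ∀ f ∈ G.edgeSet, x ∉ f → y ∉ f → e ≠ f → ∀ q ∈ arc' e,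
      q ∈ arc' f → q ∈ Set.range pos' ∨ e ∈ C ∧ D.Crosses (φ e) f q := by
    intro e he f hf hx hy hne q hq hq'
    rw [q5 f hx hy] at hq'
    have hyf : ∀ w, s(w, y) ≠ f := fun w h => hy (h ▸ Sym2.mem_mk_right _ _)
    rcases h.edge_cases he with rfl | rfl | rfl | rfl | ⟨h1, h2⟩
    · rcases hfB₁ f hf hx hy ⟨hq', q1 ▸ hq⟩ with h' | h'
      · refine (hold _ h.uy f hf hx hy (hyf u) q h' hq').imp id fun h' => ⟨⟨e₂.symm, e₄.symm⟩, ?_⟩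
        rwa [hφ]
      · exact .inl (hruv _ h')
    · rcases hfB₂ f hf hx hy ⟨hq', q2 ▸ hq⟩ with h' | h'
      · refine (hold _ h.vx f hf hx hy hne q h' hq').imp id fun h' => ⟨⟨e₃.symm, e₅.symm⟩, ?_⟩
        rwa [hφ' e₁]
      · exact .inl (hruv _ h')
    · exact .inl (hruv _ (hfA f hf hx hy ⟨hq', .inl (q3 ▸ hq)⟩))
    · exact .inl (hruv _ (hfA f hf hx hy ⟨hq', .inr (q4 ▸ hq)⟩))
    · rw [q5 e h1 h2] at hq
      refine (hold e he f hf hx hy hne q hq hq').imp id fun h' => ⟨(old e he h1 h2).1, ?_⟩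
      rwa [(old e he h1 h2).2]
  have hxr : ∀ q, q ∈ B₁ ∩ B₂ → q ∈ Set.range pos' := fun q hq => ⟨x, px.trans (hB hq).symm⟩
  have hyr : ∀ q, q ∈ A₁ ∩ A₂ → q ∈ Set.range pos' := fun q hq => ⟨y, py.trans (hA hq).symm⟩
  have hzr : ∀ q, q ∈ A₁ ∪ A₂ → q ∈ B₁ ∪ B₂ → q ∈ Set.range pos' := fun q hq hq' =>
    hruv q (hAB ⟨hq, hq'⟩)
  have key : ∀ e ∈ G.edgeSet, ∀ e' ∈ G.edgeSet, e ≠ e' → ∀ q ∈ arc' e, q ∈ arc' e' →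
      q ∈ Set.range pos' ∨ e ∈ C ∧ e' ∈ C ∧ D.Crosses (φ e) (φ e') q ∧
        ((x ∉ e ∧ y ∉ e) ∨ (x ∉ e' ∧ y ∉ e')) := by
    intro e he e' he' hne q hq hq'
    by_cases h1 : x ∉ e' ∧ y ∉ e'
    · refine (key₁ e he e' he' h1.1 h1.2 hne q hq hq').imp id fun h' => ?_
      obtain ⟨h2, h3⟩ := old e' he' h1.1 h1.2
      exact ⟨h'.1, h2, h3.symm ▸ h'.2, .inr h1⟩
    by_cases h1' : x ∉ e ∧ y ∉ e
    · refine (key₁ e' he' e he h1'.1 h1'.2 hne.symm q hq' hq).imp id fun h' => ?_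
      obtain ⟨h2, h3⟩ := old e he h1'.1 h1'.2
      exact ⟨h2, h'.1, h3.symm ▸ h'.2.symm, .inl h1'⟩
    left
    rcases h.edge_cases he with rfl | rfl | rfl | rfl | h2
    case inr.inr.inr.inr => exact absurd h2 h1'
    all_goals
      rcases h.edge_cases he' with rfl | rfl | rfl | rfl | h3
      case inr.inr.inr.inr => exact absurd h3 h1
      all_goals
        simp only [q1, q2, q3, q4] at hq hq'
        first
        | exact absurd rfl hne
        | exact hxr q ⟨hq, hq'⟩
        | exact hxr q ⟨hq', hq⟩
        | exact hyr q ⟨hq, hq'⟩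
        | exact hyr q ⟨hq', hq⟩
        | exact hzr q (.inl hq) (.inl hq')
        | exact hzr q (.inl hq) (.inr hq')
        | exact hzr q (.inr hq) (.inl hq')
        | exact hzr q (.inr hq) (.inr hq')
        | exact hzr q (.inl hq') (.inl hq)
        | exact hzr q (.inl hq') (.inr hq)
        | exact hzr q (.inr hq') (.inl hq)
        | exact hzr q (.inr hq') (.inr hq)
  let D' : Drawing G :=
    { pos := pos'
      pos_inj := by
        intro w w' hw
        by_cases h1 : w = x <;> by_cases h2 : w = y <;> by_cases h3 : w' = x <;>
          by_cases h4 : w' = y <;> grind [D.pos_inj.eq_iff]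
      arc := arc'
      arc_curve := by
        rintro e he w w' rfl
        rcases h.edge_cases he with h' | h' | h' | h' | ⟨h1, h2⟩
        · exact h' ▸ q1 ▸ IsArc.of_sym2_eq (by rwa [pu, px]) h'.symm
        · exact h' ▸ q2 ▸ IsArc.of_sym2_eq (by rw [pv, px]; exact hB₂.symm) h'.symm
        · exact h' ▸ q3 ▸ IsArc.of_sym2_eq (by rwa [pu, py]) h'.symm
        · exact h' ▸ q4 ▸ IsArc.of_sym2_eq (by rw [pv, py]; exact hA₂.symm) h'.symm
        · rw [q5 _ h1 h2]
          simp only [Sym2.mem_iff, not_or] at h1 h2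
          rw [pw w (Ne.symm h1.1) (Ne.symm h2.1), pw w' (Ne.symm h1.2) (Ne.symm h2.2)]
          exact D.isArc he
      arc_avoid := by
        intro e he w hw
        by_cases hwx : w = x
        · subst hwx
          rw [px] at hw
          rcases h.edge_cases he with rfl | rfl | rfl | rfl | ⟨h1, h2⟩
          · exact Sym2.mem_mk_right _ _
          · exact Sym2.mem_mk_right _ _
          · exact absurd (.inl (q3 ▸ hw)) hbA
          · exact absurd (.inr (q4 ▸ hw)) hbA
          · exact absurd (q5 e h1 h2 ▸ hw) (hfb e he h1 h2)
        by_cases hwy : w = y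
        · subst hwy
          rw [py] at hw
          rcases h.edge_cases he with rfl | rfl | rfl | rfl | ⟨h1, h2⟩
          · exact absurd (.inl (q1 ▸ hw)) haB
          · exact absurd (.inr (q2 ▸ hw)) haB
          · exact Sym2.mem_mk_right _ _
          · exact Sym2.mem_mk_right _ _
          · exact absurd (hfA e he h1 h2 ⟨q5 e h1 h2 ▸ hw, .inl ha₁⟩) (by simp [hau, hav])
        rw [pw w hwx hwy] at hw
        have hp := hpos w hwx hwy
        rcases h.edge_cases he with rfl | rfl | rfl | rfl | ⟨h1, h2⟩
        · rw [q1] at hw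
          rcases hp (.inr (.inl hw)) with rfl | rfl
          · exact Sym2.mem_mk_left _ _
          · exact absurd hw hvB
        · rw [q2] at hw
          rcases hp (.inr (.inr hw)) with rfl | rfl
          · exact absurd hw huB
          · exact Sym2.mem_mk_left _ _
        · rw [q3] at hw
          rcases hp (.inl (.inl hw)) with rfl | rfl
          · exact Sym2.mem_mk_left _ _
          · exact absurd hw hvA
        · rw [q4] at hw
          rcases hp (.inl (.inr hw)) with rfl | rfl
          · exact absurd hw huA
          · exact Sym2.mem_mk_left _ _
        · exact D.arc_avoid e he w (q5 e h1 h2 ▸ hw)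
      arc_finite_inter := by
        intro e he e' he' hne
        have hs : {q | D.Crosses (φ e) (φ e') q}.Subsingleton := fun q hq q' hq' =>
          (hD.1.1 _ _ _ _ _ hq hq').2
        refine ((Set.finite_range pos').union hs.finite).subset fun q hq => ?_
        exact (key e he e' he' hne q hq.1 hq.2).imp id fun h' => h'.2.2.1 }
  have hC : ∀ e e' p, D'.Crosses e e' p → e ∈ C ∧ e' ∈ C ∧ D.Crosses (φ e) (φ e') p ∧
      ((x ∉ e ∧ y ∉ e) ∨ (x ∉ e' ∧ y ∉ e')) := fun e e' p hp =>
    (key e hp.1 e' hp.2.1 hp.2.2.1 p hp.2.2.2.1 hp.2.2.2.2.1).resolve_left hp.2.2.2.2.2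
  refine ⟨D', hD.transfer D' φ C ?_ (fun e e' p hp => ?_) ?_ ?_ h.crosses fun e e' p hp => .inl ?_⟩
  · intro e he e' he' hee
    by_cases h1 : e = s(u, x) <;> by_cases h2 : e' = s(u, x) <;> simp only [φ, h1, h2] at hee ⊢
    · exact absurd (by simpa using hee.symm) he'.1
    · exact absurd (by simpa using hee) he.1
    · simpa using hee
  · obtain ⟨h1, h2, h3, -⟩ := hC e e' p hp
    exact ⟨h1, h2, h3⟩
  · have hadj : ∀ e e' p, D'.Crosses e e' p → x ∉ e' → y ∉ e' → ∀ w ∈ e, w ∉ e' := by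
      intro e e' p hp h1 h2 w hw hw'
      obtain ⟨-, -, h3, -⟩ := hC e e' p hp
      rw [(old e' hp.2.1 h1 h2).2] at h3
      refine hD.1.2 _ _ _ h3 w ?_ hw'
      by_cases h4 : e = s(u, x)
      · subst h4
        rcases Sym2.mem_iff.1 hw with rfl | rfl
        · exact hφ ▸ Sym2.mem_mk_left _ _
        · exact absurd hw' h1
      · rwa [hφ' h4]
    intro e e' p hp w hw hw'
    rcases (hC e e' p hp).2.2.2 with h1 | h1
    · exact hadj e' e p hp.symm h1.1 h1.2 w hw' hw
    · exact hadj e e' p hp h1.1 h1.2 w hw hw'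
  · have htype : ∀ a b c d p, D'.Crosses s(a, b) s(c, d) p → x ∉ s(c, d) → y ∉ s(c, d) →
        ∃ t ∈ S, HasCrossingType G a b c d t := by
      intro a b c d p hp h1 h2
      obtain ⟨-, -, h3, -⟩ := hC _ _ p hp
      rw [(old _ hp.2.1 h1 h2).2] at h3
      have hxy : ∀ w, G.Adj y w ↔ G.Adj x w := fun w => (h.adj_right w).trans (h.adj_left w).symm
      by_cases h4 : s(a, b) = s(u, x)
      · rw [h4, hφ] at h3
        rcases Sym2.eq_iff.1 h4 with ⟨rfl, rfl⟩ | ⟨rfl, rfl⟩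
        · obtain ⟨t, ht, h5⟩ := hD.2 _ _ _ _ _ h3
          exact ⟨t, ht, h5.congr .rfl .rfl (hxy _) (hxy _)⟩
        · rw [Sym2.eq_swap] at h3
          obtain ⟨t, ht, h5⟩ := hD.2 _ _ _ _ _ h3
          exact ⟨t, ht, h5.congr (hxy _) (hxy _) .rfl .rfl⟩
      · rw [hφ' h4] at h3
        exact hD.2 _ _ _ _ _ h3
    intro a b c d p hp
    rcases (hC _ _ p hp).2.2.2 with h1 | h1
    · obtain ⟨t, ht, h2⟩ := htype c d a b p hp.symm h1.1 h1.2
      exact ⟨t, ht, h2.swap⟩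
    · exact htype a b c d p hp h1.1 h1.2
  · by_cases h1 : e = s(u, x)
    · rw [h1, hφ]; exact e₂
    · rwa [hφ' h1]

end Drawing.IsTwinCrossing

end Twins

/-! ### Removing crossings -/

section Uncrossing

variable {V : Type*} {G : SimpleGraph V} {D : Drawing G} {S : Set CrossingType}

lemma IsArc.exists_split {A : Set (ℝ × ℝ)} {x y : ℝ × ℝ} (h : IsArc A x y) :
    ∃ p A₁ A₂, IsArc A₁ x p ∧ IsArc A₂ p y ∧ A₁ ∪ A₂ = A ∧ A₁ ∩ A₂ = {p} := by
  obtain ⟨f, -, hi, rfl, rfl, rfl⟩ := id h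
  let t : I := ⟨1 / 2, by norm_num, by norm_num⟩
  have h0 : t ≠ 0 := fun h => by simpa [t] using congrArg Subtype.val h
  have h1 : t ≠ 1 := fun h => by simpa [t] using congrArg Subtype.val h
  exact ⟨f t, h.split ⟨t, rfl⟩ (hi.ne h0) (hi.ne h1)⟩

lemma disjoint_join {A B C E K : Set (ℝ × ℝ)} {a b c d : ℝ × ℝ} (hK : Convex ℝ K)
    (hA : A ∩ K = {a}) (hB : B ∩ K = {b}) (hC : C ∩ K = {c}) (hE : E ∩ K = {d})
    (hAC : Disjoint A C) (hAE : Disjoint A E) (hBC : Disjoint B C) (hBE : Disjoint B E)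
    (h : Disjoint (segment ℝ a b) (segment ℝ c d)) :
    Disjoint (A ∪ segment ℝ a b ∪ B) (C ∪ segment ℝ c d ∪ E) := by
  have haK : a ∈ K := (hA.symm.subset rfl).2
  have hbK : b ∈ K := (hB.symm.subset rfl).2
  have hcK : c ∈ K := (hC.symm.subset rfl).2
  have hdK : d ∈ K := (hE.symm.subset rfl).2
  have aux : ∀ {X : Set (ℝ × ℝ)} {p r s : ℝ × ℝ} {L : Set (ℝ × ℝ)}, X ∩ K = {p} → r ∈ K →
      s ∈ K → p ∈ L → Disjoint L (segment ℝ r s) → Disjoint X (segment ℝ r s) := by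
    intro X p r s L hX hr hs hp hL
    refine Set.disjoint_left.2 fun q hq hq' => ?_
    have : q = p := hX.subset ⟨hq, hK.segment_subset hr hs hq'⟩
    exact Set.disjoint_left.1 hL hp (this ▸ hq')
  have h1 := aux hA hcK hdK (left_mem_segment ℝ a b) h
  have h2 := aux hB hcK hdK (right_mem_segment ℝ a b) h
  have h3 := aux hC haK hbK (left_mem_segment ℝ c d) h.symm
  have h4 := aux hE haK hbK (right_mem_segment ℝ c d) h.symm
  simp only [Set.disjoint_union_left, Set.disjoint_union_right]
  exact ⟨⟨⟨⟨hAC, h3.symm⟩, hBC⟩, ⟨h1, h⟩, h2⟩, ⟨hAE, h4.symm⟩, hBE⟩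

/-- Two arcs meeting in a single point can be replaced by disjoint arcs on the same four ends,
which leave the given arcs only near the common point. -/
lemma IsArc.uncross {A B Z : Set (ℝ × ℝ)} {a a' b b' c : ℝ × ℝ} (hA : IsArc A a a')
    (hB : IsArc B b b') (hAB : A ∩ B = {c}) (hZ : IsClosed Z) (hc : c ∉ Z) (ha : a ∈ Z)
    (ha' : a' ∈ Z) (hb : b ∈ Z) (hb' : b' ∈ Z) :
    ∃ K, Disjoint K Z ∧
      ((∃ N₁ N₂, IsArc N₁ a a' ∧ IsArc N₂ b b' ∧ Disjoint N₁ N₂ ∧ N₁ ⊆ A ∪ K ∧ N₂ ⊆ B ∪ K) ∨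
       (∃ N₁ N₂, IsArc N₁ a b ∧ IsArc N₂ a' b' ∧ Disjoint N₁ N₂ ∧ N₁ ⊆ A ∪ B ∪ K ∧
          N₂ ⊆ A ∪ B ∪ K)) := by
  have hcAB : c ∈ A ∩ B := hAB.symm.subset rfl
  have hne : ∀ z ∈ Z, c ≠ z := fun z hz h => hc (h ▸ hz)
  obtain ⟨U, X, hU, hX, hUX, hUX'⟩ := hA.split hcAB.1 (hne a ha) (hne a' ha')
  obtain ⟨W, Y, hW, hY, hWY, hWY'⟩ := hB.split hcAB.2 (hne b hb) (hne b' hb')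
  obtain ⟨ρ, hρ, hK⟩ := exists_disc_subset hZ hc
  have hnK : ∀ z ∈ Z, z ∉ disc c ρ := fun z hz h => Set.disjoint_left.1 hK h hz
  have tail : ∀ {A : Set (ℝ × ℝ)} {z : ℝ × ℝ}, IsArc A c z → z ∈ Z → ∃ q A', IsArc A' q z ∧
      A' ⊆ A ∧ A' ∩ disc c ρ = {q} ∧ q ∈ circ c ρ ∧ c ∉ A' := by
    intro A z h hz
    obtain ⟨q, A', h1, h2, h3, h4⟩ :=
      h.exists_tail (isClosed_disc c ρ) (center_mem_disc c ρ) (hnK z hz)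
    have h5 := mem_circ_of_mem_closure (h3.symm.subset rfl).2 h4
    refine ⟨q, A', h1, h2, h3, h5, fun h6 => ?_⟩
    have : c = q := h3.subset ⟨h6, center_mem_disc c ρ⟩
    subst this
    simp only [circ, Set.mem_ofPred_eq, sub_self] at h5
    nlinarith [pow_pos hρ 2]
  obtain ⟨qu, U', hU', sU, kU, cU, nU⟩ := tail hU.symm ha
  obtain ⟨qx, X', hX', sX, kX, cX, nX⟩ := tail hX ha'
  obtain ⟨qw, W', hW', sW, kW, cW, nW⟩ := tail hW.symm hb
  obtain ⟨qy, Y', hY', sY, kY, cY, nY⟩ := tail hY hb'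
  have dis : ∀ {M N M' N' : Set (ℝ × ℝ)}, M ∩ N ⊆ {c} → M' ⊆ M → N' ⊆ N → c ∉ M' →
      Disjoint M' N' := fun h1 h2 h3 h4 => Set.disjoint_left.2 fun q hq hq' =>
    h4 ((h1 ⟨h2 hq, h3 hq'⟩ : q = c) ▸ hq)
  have hUA : U ⊆ A := hUX ▸ Set.subset_union_left
  have hXA : X ⊆ A := hUX ▸ Set.subset_union_right
  have hWB : W ⊆ B := hWY ▸ Set.subset_union_left
  have hYB : Y ⊆ B := hWY ▸ Set.subset_union_right
  have dUX := dis hUX'.subset sU sX nU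
  have dWY := dis hWY'.subset sW sY nW
  have dUW := dis ((Set.inter_subset_inter hUA hWB).trans hAB.subset) sU sW nU
  have dUY := dis ((Set.inter_subset_inter hUA hYB).trans hAB.subset) sU sY nU
  have dXW := dis ((Set.inter_subset_inter hXA hWB).trans hAB.subset) sX sW nX
  have dXY := dis ((Set.inter_subset_inter hXA hYB).trans hAB.subset) sX sY nX
  have hcv := convex_disc c ρ
  have hsub : ∀ {M N T : Set (ℝ × ℝ)} {p r : ℝ × ℝ}, M ∩ disc c ρ = {p} → N ∩ disc c ρ = {r} →
      M ⊆ T → N ⊆ T → M ∪ segment ℝ p r ∪ N ⊆ T ∪ disc c ρ := by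
    intro M N T p r hp hr hM hN
    refine Set.union_subset (Set.union_subset (hM.trans Set.subset_union_left)
      (Set.subset_union_of_subset_right ?_ _)) (hN.trans Set.subset_union_left)
    exact hcv.segment_subset (hp.symm.subset rfl).2 (hr.symm.subset rfl).2
  have hne' : ∀ {M N : Set (ℝ × ℝ)} {p r z w : ℝ × ℝ}, IsArc M p z → IsArc N r w →
      Disjoint M N → p ≠ r := fun h1 h2 h3 h4 =>
    Set.disjoint_left.1 h3 h1.left_mem (h4 ▸ h2.left_mem)
  refine ⟨disc c ρ, hK, ?_⟩
  rcases disjoint_chords cX cW cY (hne' hX' hW' dXW) (hne' hX' hY' dXY) (hne' hW' hY' dWY)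
    (hne' hU' hY' dUY) with h | h
  · left
    exact ⟨_, _, hU'.join hcv hX' kU kX dUX, hW'.join hcv hY' kW kY dWY,
      disjoint_join hcv kU kX kW kY dUW dUY dXW dXY h,
      hsub kU kX (sU.trans hUA) (sX.trans hXA), hsub kW kY (sW.trans hWB) (sY.trans hYB)⟩
  · right
    have hA' : A ⊆ A ∪ B := Set.subset_union_left
    have hB' : B ⊆ A ∪ B := Set.subset_union_right
    exact ⟨_, _, hU'.join hcv hW' kU kW dUW, hX'.join hcv hY' kX kY dXY,
      disjoint_join hcv kU kW kX kY dUX dUY dXW.symm dWY h,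
      hsub kU kW ((sU.trans hUA).trans hA') ((sW.trans hWB).trans hB'),
      hsub kX kY ((sX.trans hXA).trans hA') ((sY.trans hYB).trans hB')⟩

/-- Locally redrawing a crossing either removes it or joins the endpoints crosswise. -/
lemma Drawing.IsOnePlanar.uncross [Finite V] (hD : D.IsOnePlanar) {u v x y : V} {c : ℝ × ℝ}
    (hc : D.Crosses s(u, x) s(v, y) c) :
    ∃ K, (∀ w, D.pos w ∉ K) ∧
      (∀ f ∈ G.edgeSet, f ≠ s(u, x) → f ≠ s(v, y) → Disjoint K (D.arc f)) ∧
      ((∃ N₁ N₂, IsArc N₁ (D.pos u) (D.pos x) ∧ IsArc N₂ (D.pos v) (D.pos y) ∧ Disjoint N₁ N₂ ∧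
          N₁ ⊆ D.arc s(u, x) ∪ K ∧ N₂ ⊆ D.arc s(v, y) ∪ K) ∨
       (∃ N₁ N₂, IsArc N₁ (D.pos u) (D.pos v) ∧ IsArc N₂ (D.pos x) (D.pos y) ∧
          Disjoint N₁ N₂ ∧ N₁ ⊆ D.arc s(u, x) ∪ D.arc s(v, y) ∪ K ∧
          N₂ ⊆ D.arc s(u, x) ∪ D.arc s(v, y) ∪ K)) := by
  let Z : Set (ℝ × ℝ) := Set.range D.pos ∪
    ⋃ f ∈ {f | f ∈ G.edgeSet ∧ f ≠ s(u, x) ∧ f ≠ s(v, y)}, D.arc f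
  have hclosed : ∀ f ∈ G.edgeSet, IsClosed (D.arc f) := by
    intro f
    induction f with | h a b => exact fun hf => (D.isArc hf).isCompact.isClosed
  have hZ : IsClosed Z := (Set.finite_range D.pos).isClosed.union
    ((Set.toFinite _).isClosed_biUnion fun f hf => hclosed f hf.1)
  have hcZ : c ∉ Z := by
    rintro (h | h)
    · exact hc.2.2.2.2.2 h
    · simp only [Set.mem_iUnion] at h
      obtain ⟨f, ⟨hf, h1, h2⟩, h⟩ := h
      obtain ⟨w, rfl, -⟩ := hD.mem_arc_inter_of_crosses hc hf h1.symm h2.symm hc.2.2.2.1 h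
      exact hc.2.2.2.2.2 ⟨w, rfl⟩
  have hmem : ∀ w, D.pos w ∈ Z := fun w => .inl ⟨w, rfl⟩
  have hi : D.arc s(u, x) ∩ D.arc s(v, y) = {c} :=
    Set.eq_singleton_iff_unique_mem.2 ⟨⟨hc.2.2.2.1, hc.2.2.2.2.1⟩,
      fun q hq => hD.eq_of_mem_arcs hc hq.1 hq.2⟩
  obtain ⟨K, hK, h⟩ := (D.isArc hc.1).uncross (D.isArc hc.2.1) hi hZ hcZ (hmem u) (hmem x)
    (hmem v) (hmem y)
  refine ⟨K, fun w hw => Set.disjoint_left.1 hK hw (hmem w), fun f hf h1 h2 => ?_, h⟩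
  exact hK.mono_right ((Set.subset_biUnion_of_mem (u := D.arc)
    (show f ∈ {f | f ∈ G.edgeSet ∧ f ≠ s(u, x) ∧ f ≠ s(v, y)} from ⟨hf, h1, h2⟩)).trans
      Set.subset_union_right)

/-- Replacing two crossing edges by disjoint curves with the same ends. -/
lemma Drawing.IsSRestricted.exists_fewer_of_disjoint [Finite V] (hD : D.IsSRestricted S)
    {u v x y : V} {c : ℝ × ℝ} (hc : D.Crosses s(u, x) s(v, y) c) {K N₁ N₂ : Set (ℝ × ℝ)}
    (hpos : ∀ w, D.pos w ∉ K)
    (hK : ∀ f ∈ G.edgeSet, f ≠ s(u, x) → f ≠ s(v, y) → Disjoint K (D.arc f))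
    (h₁ : IsArc N₁ (D.pos u) (D.pos x)) (h₂ : IsArc N₂ (D.pos v) (D.pos y))
    (hdis : Disjoint N₁ N₂) (hs₁ : N₁ ⊆ D.arc s(u, x) ∪ K) (hs₂ : N₂ ⊆ D.arc s(v, y) ∪ K) :
    ∃ D' : Drawing G, D'.IsSRestricted S ∧ D'.crossSet.ncard < D.crossSet.ncard := by
  classical
  obtain ⟨arc', q1, q2, q3⟩ : ∃ arc' : Sym2 V → Set (ℝ × ℝ), arc' s(u, x) = N₁ ∧
      arc' s(v, y) = N₂ ∧ ∀ f, f ≠ s(u, x) → f ≠ s(v, y) → arc' f = D.arc f :=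
    ⟨Function.update (Function.update D.arc s(u, x) N₁) s(v, y) N₂, by
      rw [Function.update_of_ne hc.2.2.1, Function.update_self], Function.update_self .., by
      intro f h1 h2
      rw [Function.update_of_ne h2, Function.update_of_ne h1]⟩
  have hsub : ∀ e, arc' e ⊆ D.arc e ∪ K := by
    intro e
    by_cases h1 : e = s(u, x)
    · subst h1; rwa [q1]
    by_cases h2 : e = s(v, y)
    · subst h2; rwa [q2]
    · rw [q3 e h1 h2]; exact Set.subset_union_left
  have hold : ∀ e, ∀ f ∈ G.edgeSet, f ≠ s(u, x) → f ≠ s(v, y) →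
      arc' e ∩ arc' f ⊆ D.arc e ∩ D.arc f := by
    rintro e f hf h1 h2 q ⟨hq, hq'⟩
    rw [q3 f h1 h2] at hq'
    exact ⟨(hsub e hq).resolve_right fun h => Set.disjoint_left.1 (hK f hf h1 h2) h hq', hq'⟩
  have hinter : ∀ e ∈ G.edgeSet, ∀ f ∈ G.edgeSet, e ≠ f →
      arc' e ∩ arc' f ⊆ D.arc e ∩ D.arc f := by
    intro e he f hf hne
    by_cases hf' : f ≠ s(u, x) ∧ f ≠ s(v, y)
    · exact hold e f hf hf'.1 hf'.2
    by_cases he' : e ≠ s(u, x) ∧ e ≠ s(v, y)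
    · rw [Set.inter_comm, Set.inter_comm (D.arc e)]
      exact hold f e he he'.1 he'.2
    rintro q ⟨hq, hq'⟩
    have : (e = s(u, x) ∧ f = s(v, y)) ∨ (e = s(v, y) ∧ f = s(u, x)) := by
      by_cases h1 : e = s(u, x) <;> by_cases h2 : f = s(u, x) <;> grind
    rcases this with ⟨rfl, rfl⟩ | ⟨rfl, rfl⟩
    · exact absurd (q2 ▸ hq') (Set.disjoint_left.1 hdis (q1 ▸ hq))
    · exact absurd (q2 ▸ hq) (Set.disjoint_left.1 hdis (q1 ▸ hq'))
  let D' : Drawing G :=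
    { pos := D.pos
      pos_inj := D.pos_inj
      arc := arc'
      arc_curve := by
        rintro e he w w' rfl
        by_cases h1 : s(w, w') = s(u, x)
        · rw [h1, q1]; exact h₁.of_sym2_eq h1.symm
        by_cases h2 : s(w, w') = s(v, y)
        · rw [h2, q2]; exact h₂.of_sym2_eq h2.symm
        · rw [q3 _ h1 h2]; exact D.isArc he
      arc_avoid := fun e he w hw => D.arc_avoid e he w ((hsub e hw).resolve_right (hpos w))
      arc_finite_inter := fun e he f hf hne =>
        (D.arc_finite_inter e he f hf hne).subset (hinter e he f hf hne) }
  have hC : ∀ e e' p, D'.Crosses e e' p → D.Crosses e e' p := fun e e' p h =>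
    have := hinter e h.1 e' h.2.1 h.2.2.1 ⟨h.2.2.2.1, h.2.2.2.2.1⟩
    ⟨h.1, h.2.1, h.2.2.1, this.1, this.2, h.2.2.2.2.2⟩
  refine ⟨D', hD.transfer D' id Set.univ Function.injective_id.injOn
    (fun e e' p h => ⟨trivial, trivial, hC e e' p h⟩) (fun e e' p h => hD.1.2 _ _ _ (hC _ _ _ h))
    (fun a b c d p h => hD.2 _ _ _ _ _ (hC _ _ _ h)) hc fun e e' p h => ?_⟩
  by_contra! h'
  obtain ⟨rfl, rfl⟩ : e = s(u, x) ∧ e' = s(v, y) := h'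
  exact Set.disjoint_left.1 hdis (q1.subset h.2.2.2.1) (q2.subset h.2.2.2.2.1)

namespace Drawing.IsTwinCrossing

variable {u v x y : V} {c : ℝ × ℝ}

lemma exists_fewer_of_crosses [Finite V] (h : D.IsTwinCrossing u v x y c)
    (hD : D.IsSRestricted S) {c' : ℝ × ℝ} (hc' : D.Crosses s(u, y) s(v, x) c') :
    ∃ D' : Drawing G, D'.IsSRestricted S ∧ D'.crossSet.ncard < D.crossSet.ncard := by
  obtain ⟨A₁, sA₁, hA₁, pA₁⟩ := h.crosses.exists_half
  obtain ⟨A₂, sA₂, hA₂, pA₂⟩ := h.crosses.symm.exists_half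
  obtain ⟨B₁, sB₁, hB₁, pB₁⟩ := hc'.exists_half
  obtain ⟨B₂, sB₂, hB₂, pB₂⟩ := hc'.symm.exists_half
  have hxu : x ≠ u := h.ux.ne'
  have hyv : y ≠ v := h.vy.ne'
  have hsw := fun a b : V => Sym2.eq_swap (a := a) (b := b)
  refine h.reroute hD hA₁ hA₂.symm hB₁ hB₂.symm
    (fun q hq => hD.1.eq_of_mem_arcs h.crosses (sA₁ hq.1) (sA₂ hq.2))
    (fun q hq => hD.1.eq_of_mem_arcs hc' (sB₁ hq.1) (sB₂ hq.2)) ?_ ?_ ?_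
    (fun f _ _ _ q hq => .inl (sB₁ hq.2)) (fun f _ _ _ q hq => .inl (sB₂ hq.2)) ?_
  · rintro q ⟨hA | hA, hB | hB⟩
    · exact .inl (hD.1.mem_arc_inter_of_adj h.ux h.uy h.ne' (sA₁ hA) (sB₁ hB))
    · obtain rfl := hD.1.mem_arc_inter_of_adj h.ux.symm h.vx.symm h.ne (hsw u x ▸ sA₁ hA)
        (hsw v x ▸ sB₂ hB)
      exact absurd (pA₁ _ hA) hxu
    · obtain rfl := hD.1.mem_arc_inter_of_adj h.vy.symm h.uy.symm h.ne.symm (hsw v y ▸ sA₂ hA)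
        (hsw u y ▸ sB₁ hB)
      exact absurd (pA₂ _ hA) hyv
    · exact .inr (hD.1.mem_arc_inter_of_adj h.vy h.vx h.ne'.symm (sA₂ hA) (sB₂ hB))
  · rintro w - - ((hw | hw) | (hw | hw))
    exacts [.inl (pA₁ w hw), .inr (pA₂ w hw), .inl (pB₁ w hw), .inr (pB₂ w hw)]
  · rintro f hf hx hy q ⟨hq, hA | hA⟩
    · obtain ⟨w, rfl, -, -⟩ := hD.1.mem_arc_inter_of_crosses h.crosses hf
        (fun h => hx (h ▸ Sym2.mem_mk_right _ _)) (fun h => hy (h ▸ Sym2.mem_mk_right _ _))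
        (sA₁ hA) hq
      exact .inl (congrArg _ (pA₁ w hA))
    · obtain ⟨w, rfl, -, -⟩ := hD.1.mem_arc_inter_of_crosses h.crosses.symm hf
        (fun h => hy (h ▸ Sym2.mem_mk_right _ _)) (fun h => hx (h ▸ Sym2.mem_mk_right _ _))
        (sA₂ hA) hq
      exact .inr (congrArg _ (pA₂ w hA))
  · intro f hf hx hy hq
    obtain ⟨w, rfl, -, -⟩ := hD.1.mem_arc_inter_of_crosses hc' hf
        (fun h => hy (h ▸ Sym2.mem_mk_right _ _)) (fun h => hx (h ▸ Sym2.mem_mk_right _ _))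
        hc'.2.2.2.1 hq
    exact hc'.2.2.2.2.2 ⟨w, rfl⟩

lemma exists_fewer_of_joins [Finite V] (h : D.IsTwinCrossing u v x y c)
    (hD : D.IsSRestricted S) (hnc : ∀ c', ¬ D.Crosses s(u, y) s(v, x) c') {K N₁ N₂ : Set (ℝ × ℝ)}
    (hpos : ∀ w, D.pos w ∉ K)
    (hK : ∀ f ∈ G.edgeSet, f ≠ s(u, x) → f ≠ s(v, y) → Disjoint K (D.arc f))
    (h₁ : IsArc N₁ (D.pos u) (D.pos v)) (h₂ : IsArc N₂ (D.pos x) (D.pos y))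
    (hdis : Disjoint N₁ N₂) (hs₁ : N₁ ⊆ D.arc s(u, x) ∪ D.arc s(v, y) ∪ K)
    (hs₂ : N₂ ⊆ D.arc s(u, x) ∪ D.arc s(v, y) ∪ K) :
    ∃ D' : Drawing G, D'.IsSRestricted S ∧ D'.crossSet.ncard < D.crossSet.ncard := by
  have hux := h.ux.ne
  have huy := h.uy.ne
  have hvx := h.vx.ne
  have hvy := h.vy.ne
  have huv := h.ne
  have hxy := h.ne'
  have hsw := fun a b : V => Sym2.eq_swap (a := a) (b := b)
  have hKuy := hK s(u, y) h.uy (by simp [huy.symm, hxy.symm, hux]) (by simp [huv, huy])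
  have hKvx := hK s(v, x) h.vx (by simp [huv.symm, hvx]) (by simp [hxy, hvy])
  have iu : ∀ q ∈ D.arc s(u, x), q ∈ D.arc s(u, y) → q = D.pos u := fun q =>
    hD.1.mem_arc_inter_of_adj h.ux h.uy hxy
  have iv : ∀ q ∈ D.arc s(v, y), q ∈ D.arc s(v, x) → q = D.pos v := fun q =>
    hD.1.mem_arc_inter_of_adj h.vy h.vx hxy.symm
  have ix : ∀ q ∈ D.arc s(u, x), q ∈ D.arc s(v, x) → q = D.pos x := fun q hq hq' =>
    hD.1.mem_arc_inter_of_adj h.ux.symm h.vx.symm huv (hsw u x ▸ hq) (hsw v x ▸ hq')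
  have iy : ∀ q ∈ D.arc s(v, y), q ∈ D.arc s(u, y) → q = D.pos y := fun q hq hq' =>
    hD.1.mem_arc_inter_of_adj h.vy.symm h.uy.symm huv.symm (hsw v y ▸ hq) (hsw u y ▸ hq')
  have hnu : D.pos u ∉ N₂ := Set.disjoint_left.1 hdis h₁.left_mem
  have hnv : D.pos v ∉ N₂ := Set.disjoint_left.1 hdis h₁.right_mem
  have hnx : D.pos x ∉ N₁ := Set.disjoint_right.1 hdis h₂.left_mem
  have hny : D.pos y ∉ N₁ := Set.disjoint_right.1 hdis h₂.right_mem
  have j₁u : ∀ q ∈ N₁, q ∈ D.arc s(u, y) → q = D.pos u := by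
    intro q hq hq'
    rcases hs₁ hq with (h1 | h1) | h1
    · exact iu q h1 hq'
    · exact absurd (iy q h1 hq' ▸ hq) hny
    · exact absurd hq' (Set.disjoint_left.1 hKuy h1)
  have j₁v : ∀ q ∈ N₁, q ∈ D.arc s(v, x) → q = D.pos v := by
    intro q hq hq'
    rcases hs₁ hq with (h1 | h1) | h1
    · exact absurd (ix q h1 hq' ▸ hq) hnx
    · exact iv q h1 hq'
    · exact absurd hq' (Set.disjoint_left.1 hKvx h1)
  have j₂u : ∀ q ∈ N₂, q ∈ D.arc s(u, y) → q = D.pos y := by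
    intro q hq hq'
    rcases hs₂ hq with (h1 | h1) | h1
    · exact absurd (iu q h1 hq' ▸ hq) hnu
    · exact iy q h1 hq'
    · exact absurd hq' (Set.disjoint_left.1 hKuy h1)
  have j₂v : ∀ q ∈ N₂, q ∈ D.arc s(v, x) → q = D.pos x := by
    intro q hq hq'
    rcases hs₂ hq with (h1 | h1) | h1
    · exact ix q h1 hq'
    · exact absurd (iv q h1 hq' ▸ hq) hnv
    · exact absurd hq' (Set.disjoint_left.1 hKvx h1)
  have hf : ∀ f ∈ G.edgeSet, x ∉ f → y ∉ f → ∀ q ∈ D.arc f,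
      q ∈ D.arc s(u, x) ∪ D.arc s(v, y) ∪ K → q ∈ ({D.pos u, D.pos v} : Set (ℝ × ℝ)) := by
    intro f hf hx hy q hq hq'
    have n1 : s(u, x) ≠ f := fun h => hx (h ▸ Sym2.mem_mk_right _ _)
    have n2 : s(v, y) ≠ f := fun h => hy (h ▸ Sym2.mem_mk_right _ _)
    rcases hq' with (h1 | h1) | h1
    · obtain ⟨w, rfl, hw, hw'⟩ := hD.1.mem_arc_inter_of_crosses h.crosses hf n1 n2 h1 hq
      rcases Sym2.mem_iff.1 hw with rfl | rfl
      exacts [.inl rfl, absurd hw' hx]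
    · obtain ⟨w, rfl, hw, hw'⟩ := hD.1.mem_arc_inter_of_crosses h.crosses.symm hf n2 n1 h1 hq
      rcases Sym2.mem_iff.1 hw with rfl | rfl
      exacts [.inr rfl, absurd hw' hy]
    · exact absurd hq (Set.disjoint_left.1 (hK f hf n1.symm n2.symm) h1)
  obtain ⟨a, A₁, A₂, hA₁, hA₂, hA, hA'⟩ := h₁.exists_split
  have hB₁ := (D.isArc h.uy).concat h₂.symm fun q hq => j₂u q hq.2 hq.1
  have hw₁ : ∀ {w z : V}, G.Adj z x → D.pos w ∈ D.arc s(z, x) → w ≠ x → w = z := by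
    intro w z hz hw hne
    exact (Sym2.mem_iff.1 (D.arc_avoid _ hz w hw)).resolve_right hne
  have hw₂ : ∀ {w z : V}, G.Adj z y → D.pos w ∈ D.arc s(z, y) → w ≠ y → w = z := by
    intro w z hz hw hne
    exact (Sym2.mem_iff.1 (D.arc_avoid _ hz w hw)).resolve_right hne
  have hN : ∀ w, w ≠ x → w ≠ y → D.pos w ∈ D.arc s(u, x) ∪ D.arc s(v, y) ∪ K →
      w = u ∨ w = v := by
    rintro w hx hy ((h1 | h1) | h1)
    exacts [.inl (hw₁ h.ux h1 hx), .inr (hw₂ h.vy h1 hy), absurd h1 (hpos w)]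
  refine h.reroute hD hA₁ hA₂ hB₁ (D.isArc h.vx).symm hA'.subset ?_ ?_ ?_ ?_ ?_ ?_ ?_
  · rintro q ⟨h1 | h1, h2⟩
    · have := hnc q
      rcases D.mem_arc_inter h.uy h.vx (by simp [huv, hux]) h1 h2 with ⟨w, -, h3, h4⟩ | h3
      · simp only [Sym2.mem_iff] at h3 h4
        grind
      · exact absurd h3 this
    · exact j₂v q h1 h2
  · rw [hA]
    rintro q ⟨h1, (h2 | h2) | h2⟩
    · exact .inl (j₁u q h1 h2)
    · exact absurd h2 (Set.disjoint_left.1 hdis h1)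
    · exact .inr (j₁v q h1 h2)
  · rw [hA]
    rintro w hx hy (h1 | (h1 | h1) | h1)
    · exact hN w hx hy (hs₁ h1)
    · exact .inl (hw₂ h.uy h1 hy)
    · exact hN w hx hy (hs₂ h1)
    · exact .inr (hw₁ h.vx h1 hx)
  · rw [hA]
    exact fun f hf' hx hy q hq => hf f hf' hx hy q hq.1 (hs₁ hq.2)
  · rintro f hf' hx hy q ⟨hq, h1 | h1⟩
    · exact .inl h1
    · exact .inr (hf f hf' hx hy q hq (hs₂ h1))
  · exact fun f _ _ _ q hq => .inl hq.2
  · exact fun f hf' hx _ h' => hx (D.arc_avoid f hf' x h')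

/-- A drawing with a twin crossing can be redrawn with fewer crossings. -/
lemma exists_fewer [Finite V] (h : D.IsTwinCrossing u v x y c) (hD : D.IsSRestricted S) :
    ∃ D' : Drawing G, D'.IsSRestricted S ∧ D'.crossSet.ncard < D.crossSet.ncard := by
  by_cases hc' : ∃ c', D.Crosses s(u, y) s(v, x) c'
  · exact h.exists_fewer_of_crosses hD hc'.choose_spec
  obtain ⟨K, hpos, hK, ⟨N₁, N₂, h1, h2, h3, h4, h5⟩ | ⟨N₁, N₂, h1, h2, h3, h4, h5⟩⟩ :=
    hD.1.uncross h.crosses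
  · exact hD.exists_fewer_of_disjoint h.crosses hpos hK h1 h2 h3 h4 h5
  · exact h.exists_fewer_of_joins hD (not_exists.1 hc') hpos hK h1 h2 h3 h4 h5

end Drawing.IsTwinCrossing

lemma SRestricted.exists_noTwinCrossing [Finite V] (h : SRestricted G S) :
    ∃ D : Drawing G, D.IsSRestricted S ∧ ∀ u v x y c, ¬ D.IsTwinCrossing u v x y c := by
  obtain ⟨D, hD⟩ := h
  induction hn : D.crossSet.ncard using Nat.strong_induction_on generalizing D with
  | _ n ih =>
    by_cases hbad : ∃ u v x y c, D.IsTwinCrossing u v x y c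
    · obtain ⟨u, v, x, y, c, hbad⟩ := hbad
      obtain ⟨D', hD', hlt⟩ := hbad.exists_fewer hD
      exact ih _ (hn ▸ hlt) D' hD' rfl
    · push Not at hbad
      exact ⟨D, hD, hbad⟩

end Uncrossing

/-! ### The planarization of a drawing -/

section Planarization

variable {V : Type*} {G : SimpleGraph V} {D : Drawing G}

/-- The unordered pairs of crossing edges. -/
def Drawing.crossingPairs (D : Drawing G) : Set (Sym2 (Sym2 V)) :=
  {P | ∃ e e' p, P = s(e, e') ∧ D.Crosses e e' p}

lemma Drawing.Crosses.mem_crossingPairs {e e' : Sym2 V} {p : ℝ × ℝ} (h : D.Crosses e e' p) :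
    s(e, e') ∈ D.crossingPairs :=
  ⟨e, e', p, rfl, h⟩

lemma Drawing.exists_crosses_of_mem {P : Sym2 (Sym2 V)} (hP : P ∈ D.crossingPairs) :
    ∃ p, ∀ e ∈ P, ∃ e', P = s(e, e') ∧ D.Crosses e e' p := by
  obtain ⟨e, e', p, rfl, h⟩ := hP
  refine ⟨p, fun f hf => ?_⟩
  rcases Sym2.mem_iff.1 hf with rfl | rfl
  exacts [⟨e', rfl, h⟩, ⟨e, Sym2.eq_swap, h.symm⟩]

lemma Drawing.IsOnePlanar.eq_of_mem_crossingPairs (hD : D.IsOnePlanar) {P P' : Sym2 (Sym2 V)}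
    (hP : P ∈ D.crossingPairs) (hP' : P' ∈ D.crossingPairs) {e : Sym2 V} (he : e ∈ P)
    (he' : e ∈ P') : P = P' := by
  obtain ⟨p, hp⟩ := D.exists_crosses_of_mem hP
  obtain ⟨p', hp'⟩ := D.exists_crosses_of_mem hP'
  obtain ⟨f, rfl, hf⟩ := hp e he
  obtain ⟨f', rfl, hf'⟩ := hp' e he'
  rw [(hD.1 _ _ _ _ _ hf hf').1]

lemma Drawing.IsOnePlanar.mem_of_mem_arc (hD : D.IsOnePlanar) {e e' f : Sym2 V} {p : ℝ × ℝ}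
    (hc : D.Crosses e e' p) (hf : f ∈ G.edgeSet) (hp : p ∈ D.arc f) : f ∈ s(e, e') := by
  by_contra h
  rw [Sym2.mem_iff, not_or] at h
  obtain ⟨w, rfl, -⟩ := hD.mem_arc_inter_of_crosses hc hf (Ne.symm h.1) (Ne.symm h.2)
    hc.2.2.2.1 hp
  exact hc.2.2.2.2.2 ⟨w, rfl⟩

/-- A crossing cuts an edge into two curves, one for each endpoint. -/
lemma Drawing.IsOnePlanar.exists_halves (hD : D.IsOnePlanar) (e : Sym2 V) :
    ∃ H : V → Set (ℝ × ℝ), ∀ e' p, D.Crosses e e' p →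
      (∀ u ∈ e, IsArc (H u) (D.pos u) p ∧ H u ⊆ D.arc e ∧ ∀ w, D.pos w ∈ H u → w = u) ∧
      ∀ u ∈ e, ∀ w ∈ e, u ≠ w → H u ∩ H w ⊆ {p} := by
  classical
  by_cases hc : ∃ e' p, D.Crosses e e' p
  swap
  · exact ⟨fun _ => ∅, fun e' p h => absurd ⟨e', p, h⟩ hc⟩
  obtain ⟨e₀, p, hc⟩ := hc
  induction e with | h u x =>
  obtain ⟨A₁, A₂, h1, h2, h3, h4⟩ := hc.split
  have hux : u ≠ x := (show G.Adj u x from hc.1).ne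
  have hmem : ∀ w, D.pos w ∈ A₁ ∪ A₂ → w = u ∨ w = x := fun w hw =>
    Sym2.mem_iff.1 (D.arc_avoid _ hc.1 w (h3 ▸ hw))
  have hp : ∀ w, D.pos w ∈ A₁ → D.pos w ∉ A₂ := fun w hw hw' =>
    hc.2.2.2.2.2 ⟨w, h4.subset ⟨hw, hw'⟩⟩
  obtain ⟨H, hu, hx⟩ : ∃ H : V → Set (ℝ × ℝ), H u = A₁ ∧ H x = A₂ :=
    ⟨fun w => if w = u then A₁ else A₂, if_pos rfl, if_neg hux.symm⟩
  refine ⟨H, fun e' q hq => ?_⟩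
  obtain ⟨rfl, rfl⟩ := hD.1 _ _ _ _ _ hc hq
  refine ⟨fun w hw => ?_, fun w hw z hz hwz => ?_⟩
  · rcases Sym2.mem_iff.1 hw with rfl | rfl
    · rw [hu]
      exact ⟨h1, h3 ▸ Set.subset_union_left, fun z hz => (hmem z (.inl hz)).resolve_right
        fun h => hp z hz (h ▸ h2.right_mem)⟩
    · rw [hx]
      exact ⟨h2.symm, h3 ▸ Set.subset_union_right, fun z hz => (hmem z (.inr hz)).resolve_left
        fun h => hp z (h ▸ h1.left_mem) hz⟩
  · rcases Sym2.mem_iff.1 hw with rfl | rfl <;> rcases Sym2.mem_iff.1 hz with rfl | rfl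
    · exact absurd rfl hwz
    · rw [hu, hx]; exact h4.subset
    · rw [hu, hx, Set.inter_comm]; exact h4.subset
    · exact absurd rfl hwz

lemma exists_injective_avoiding {α : Type*} [Finite α] {K : Set (ℝ × ℝ)} (hK : IsCompact K) :
    ∃ f : α → ℝ × ℝ, Function.Injective f ∧ ∀ a, f a ∉ K := by
  have hinf : (Kᶜ).Infinite := fun h => by
    have := hK.union h.isCompact
    rw [Set.union_compl_self] at this
    exact noncompact_univ _ this
  have := hinf.to_subtype
  obtain ⟨n, ⟨e⟩⟩ := Finite.exists_equiv_fin α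
  let g := Infinite.natEmbedding (Kᶜ : Set (ℝ × ℝ))
  exact ⟨fun a => g (e a), fun a b h => e.injective (Fin.val_injective
    (g.injective (Subtype.val_injective h))), fun a => (g (e a)).2⟩

/-- Positions for the vertices of the planarization: the crossings, and points far away for the
isolated vertices. -/
lemma Drawing.IsOnePlanar.exists_pos [Finite V] (hD : D.IsOnePlanar) :
    ∃ pt : Sym2 (Sym2 V) → ℝ × ℝ, Function.Injective pt ∧ (∀ P w, pt P ≠ D.pos w) ∧
      (∀ P ∈ D.crossingPairs, ∀ e ∈ P, ∃ e', P = s(e, e') ∧ D.Crosses e e' (pt P)) ∧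
      ∀ P, ∀ f ∈ G.edgeSet, pt P ∈ D.arc f → P ∈ D.crossingPairs ∧ f ∈ P := by
  classical
  have hcomp : ∀ f ∈ G.edgeSet, IsCompact (D.arc f) := by
    intro f
    induction f with | h a b => exact fun hf => (D.isArc hf).isCompact
  obtain ⟨o, ho, ho'⟩ := exists_injective_avoiding (α := Sym2 (Sym2 V))
    ((Set.finite_range D.pos).isCompact.union
      ((Set.toFinite G.edgeSet).isCompact_biUnion hcomp))
  have hop : ∀ P w, o P ≠ D.pos w := fun P w h => ho' P (.inl ⟨w, h.symm⟩)
  have hoa : ∀ P, ∀ f ∈ G.edgeSet, o P ∉ D.arc f := fun P f hf h =>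
    ho' P (.inr (Set.mem_biUnion hf h))
  choose! c hc using fun P (hP : P ∈ D.crossingPairs) => D.exists_crosses_of_mem hP
  have hc' : ∀ P ∈ D.crossingPairs, (∀ w, c P ≠ D.pos w) ∧
      (∀ f ∈ G.edgeSet, c P ∈ D.arc f → f ∈ P) ∧ ∃ e ∈ P, e ∈ G.edgeSet ∧ c P ∈ D.arc e := by
    intro P hP
    obtain ⟨e, e', p, rfl, -⟩ := id hP
    obtain ⟨f, h1, h2⟩ := hc _ hP e (Sym2.mem_mk_left _ _)
    refine ⟨fun w h => h2.2.2.2.2.2 ⟨w, h.symm⟩, fun g hg h => ?_, e, Sym2.mem_mk_left _ _, h2.1,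
      h2.2.2.2.1⟩
    rw [h1]
    exact hD.mem_of_mem_arc h2 hg h
  refine ⟨fun P => if P ∈ D.crossingPairs then c P else o P, fun P Q h => ?_, fun P w => ?_,
    fun P hP => ?_, fun P f hf h => ?_⟩
  · by_cases hP : P ∈ D.crossingPairs <;> by_cases hQ : Q ∈ D.crossingPairs <;>
      simp only [hP, hQ, if_true, if_false] at h
    · obtain ⟨e, he, he', h1⟩ := (hc' P hP).2.2
      exact hD.eq_of_mem_crossingPairs hP hQ he ((hc' Q hQ).2.1 e he' (h ▸ h1))
    · obtain ⟨e, he, he', h1⟩ := (hc' P hP).2.2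
      exact absurd (h ▸ h1) (hoa Q e he')
    · obtain ⟨e, he, he', h1⟩ := (hc' Q hQ).2.2
      exact absurd (h ▸ h1) (hoa P e he')
    · exact ho h
  · dsimp only
    split_ifs with hP
    exacts [(hc' P hP).1 w, hop P w]
  · simp only [hP, if_true]
    exact hc P hP
  · dsimp only at h
    split_ifs at h with hP
    exacts [⟨hP, (hc' P hP).2.1 f hf h⟩, absurd h (hoa P f hf)]

lemma planarizationBy_edge_cases {CP : Set (Sym2 (Sym2 V))} {E : Sym2 (V ⊕ Sym2 (Sym2 V))}
    (hE : E ∈ (planarizationBy G CP).edgeSet) :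
    (∃ u w, E = s(.inl u, .inl w) ∧ G.Adj u w ∧ ∀ P ∈ CP, s(u, w) ∉ P) ∨
    (∃ u x P, E = s(.inl u, .inr P) ∧ P ∈ CP ∧ s(u, x) ∈ P) := by
  induction E with | h a b =>
  rcases hE.2 with (⟨u, w, rfl, rfl, h⟩ | ⟨u, P, rfl, rfl, hP, e, he, x, rfl⟩) |
    (⟨u, w, rfl, rfl, h⟩ | ⟨u, P, rfl, rfl, hP, e, he, x, rfl⟩)
  · exact .inl ⟨u, w, rfl, h⟩
  · exact .inr ⟨u, x, P, rfl, hP, he⟩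
  · exact .inl ⟨u, w, Sym2.eq_swap, h⟩
  · exact .inr ⟨u, x, P, Sym2.eq_swap, hP, he⟩

/-- Replacing the crossings of a 1-planar drawing by vertices gives a planar graph. -/
lemma Drawing.IsOnePlanar.isPlanarGraph_planarizationBy [Finite V] (hD : D.IsOnePlanar) :
    IsPlanarGraph (planarizationBy G D.crossingPairs) := by
  obtain ⟨pt, pt_inj, pt_pos, hpt, hpt'⟩ := hD.exists_pos
  choose H hH using hD.exists_halves
  let pos' : V ⊕ Sym2 (Sym2 V) → ℝ × ℝ := Sum.elim D.pos pt
  have hHP : ∀ P ∈ D.crossingPairs, ∀ e ∈ P, e ∈ G.edgeSet ∧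
      (∀ u ∈ e, IsArc (H e u) (D.pos u) (pt P) ∧ H e u ⊆ D.arc e ∧
        ∀ w, D.pos w ∈ H e u → w = u) ∧
      ∀ u ∈ e, ∀ w ∈ e, u ≠ w → H e u ∩ H e w ⊆ {pt P} := by
    intro P hP e he
    obtain ⟨e', rfl, h⟩ := hpt P hP e he
    exact ⟨h.1, hH e _ _ h⟩
  have hE : ∀ E ∈ (planarizationBy G D.crossingPairs).edgeSet, ∃ A,
      (∃ u w, E = s(.inl u, .inl w) ∧ G.Adj u w ∧ (∀ P ∈ D.crossingPairs, s(u, w) ∉ P) ∧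
        A = D.arc s(u, w)) ∨
      (∃ u x P, E = s(.inl u, .inr P) ∧ P ∈ D.crossingPairs ∧ s(u, x) ∈ P ∧
        A = H s(u, x) u) := by
    intro E hE
    rcases planarizationBy_edge_cases hE with
      ⟨u, w, h1, h2, h3⟩ | ⟨u, x, P, h1, h2, h3⟩
    · exact ⟨_, .inl ⟨u, w, h1, h2, h3, rfl⟩⟩
    · exact ⟨_, .inr ⟨u, x, P, h1, h2, h3, rfl⟩⟩
  choose! arc' harc using hE
  have hsub : ∀ E ∈ (planarizationBy G D.crossingPairs).edgeSet,
      ∃ f ∈ G.edgeSet, arc' E ⊆ D.arc f := by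
    intro E hE
    rcases harc E hE with ⟨u, w, -, h, -, h'⟩ | ⟨u, x, P, -, hP, hux, h'⟩
    · exact ⟨s(u, w), h, h'.subset⟩
    · exact ⟨s(u, x), (hHP P hP _ hux).1,
        h' ▸ ((hHP P hP _ hux).2.1 u (Sym2.mem_mk_left _ _)).2.1⟩
  have key : ∀ E ∈ (planarizationBy G D.crossingPairs).edgeSet,
      ∀ E' ∈ (planarizationBy G D.crossingPairs).edgeSet, E ≠ E' →
      arc' E ∩ arc' E' ⊆ Set.range pos' := by
    rintro E hE E' hE' hne q ⟨hq, hq'⟩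
    have hvert : ∀ w, D.pos w ∈ Set.range pos' := fun w => ⟨.inl w, rfl⟩
    have huncr : ∀ e f : Sym2 V, e ∈ G.edgeSet → f ∈ G.edgeSet → e ≠ f →
        (∀ P ∈ D.crossingPairs, e ∉ P) → q ∈ D.arc e → q ∈ D.arc f → q ∈ Set.range pos' := by
      intro e f he hf hef hP h1 h2
      rcases D.mem_arc_inter he hf hef h1 h2 with ⟨w, rfl, -⟩ | h
      · exact hvert w
      · exact absurd (Sym2.mem_mk_left _ _) (hP _ h.mem_crossingPairs)
    rcases harc E hE with ⟨u, w, rfl, h, hP, h1⟩ | ⟨u, x, P, rfl, hP, hux, h1⟩ <;>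
      rcases harc E' hE' with ⟨u', w', rfl, h', hP', h1'⟩ | ⟨u', x', P', rfl, hP', hux', h1'⟩
    · rw [h1] at hq
      rw [h1'] at hq'
      refine huncr _ _ h h' (fun h => hne ?_) hP hq hq'
      rcases Sym2.eq_iff.1 h with ⟨rfl, rfl⟩ | ⟨rfl, rfl⟩
      exacts [rfl, Sym2.eq_swap]
    · rw [h1] at hq
      rw [h1'] at hq'
      have hb := hHP P' hP' _ hux'
      exact huncr _ _ h hb.1 (fun h : s(u, w) = s(u', x') => hP P' hP' (h ▸ hux')) hP hq
        ((hb.2.1 u' (Sym2.mem_mk_left _ _)).2.1 hq')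
    · rw [h1] at hq
      rw [h1'] at hq'
      have hb := hHP P hP _ hux
      exact huncr _ _ h' hb.1 (fun h : s(u', w') = s(u, x) => hP' P hP (h ▸ hux)) hP' hq'
        ((hb.2.1 u (Sym2.mem_mk_left _ _)).2.1 hq)
    · rw [h1] at hq
      rw [h1'] at hq'
      have hb := hHP P hP _ hux
      have hb' := hHP P' hP' _ hux'
      have hbu := hb.2.1 u (Sym2.mem_mk_left _ _)
      have hbu' := hb'.2.1 u' (Sym2.mem_mk_left _ _)
      by_cases hee : s(u, x) = s(u', x')
      · obtain rfl := hD.eq_of_mem_crossingPairs hP hP' hux (hee ▸ hux')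
        have huu : u ≠ u' := by rintro rfl; exact hne rfl
        rw [← hee] at hq'
        exact ⟨.inr P, (hb.2.2 u (Sym2.mem_mk_left _ _) u' (hee ▸ Sym2.mem_mk_left _ _) huu
          ⟨hq, hq'⟩).symm⟩
      · rcases D.mem_arc_inter hb.1 hb'.1 hee (hbu.2.1 hq) (hbu'.2.1 hq') with ⟨w, rfl, -⟩ | h
        · exact hvert w
        · obtain ⟨f, -, h2⟩ := hpt P hP _ hux
          exact ⟨.inr P, (hD.1 _ _ _ _ _ h2 h).2⟩
  refine ⟨{ pos := pos'
            pos_inj := D.pos_inj.sumElim pt_inj fun w P => (pt_pos P w).symm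
            arc := arc'
            arc_curve := ?_
            arc_avoid := ?_
            arc_finite_inter := fun E hE E' hE' hne =>
              (Set.finite_range pos').subset (key E hE E' hE' hne) }, ?_⟩
  · rintro E hE a b rfl
    rcases harc _ hE with ⟨u, w, h1, h, hP, h2⟩ | ⟨u, x, P, h1, hP, hux, h2⟩
    · rw [h2]
      exact IsArc.of_sym2_eq (pos := pos') (u := .inl u) (v := .inl w) (D.isArc h) h1.symm
    · rw [h2]
      exact IsArc.of_sym2_eq (pos := pos') (u := .inl u) (v := .inr P)
        ((hHP P hP _ hux).2.1 u (Sym2.mem_mk_left _ _)).1 h1.symm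
  · rintro E hE (w | Q) hw
    · rcases harc E hE with ⟨u, z, rfl, h, hP, h1⟩ | ⟨u, x, P, rfl, hP, hux, h1⟩
      · rcases Sym2.mem_iff.1 (D.arc_avoid _ h w (h1 ▸ hw)) with rfl | rfl
        exacts [Sym2.mem_mk_left _ _, Sym2.mem_mk_right _ _]
      · obtain rfl := ((hHP P hP _ hux).2.1 u (Sym2.mem_mk_left _ _)).2.2 w (h1 ▸ hw)
        exact Sym2.mem_mk_left _ _
    · rcases harc E hE with ⟨u, z, rfl, h, hP, h1⟩ | ⟨u, x, P, rfl, hP, hux, h1⟩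
      · obtain ⟨h2, h3⟩ := hpt' Q _ h (h1 ▸ hw)
        exact absurd h3 (hP Q h2)
      · have hb := hHP P hP _ hux
        obtain ⟨h2, h3⟩ := hpt' Q _ hb.1 ((hb.2.1 u (Sym2.mem_mk_left _ _)).2.1 (h1 ▸ hw))
        obtain rfl := hD.eq_of_mem_crossingPairs hP h2 hux h3
        exact Sym2.mem_mk_right _ _
  · exact fun E E' q h => h.2.2.2.2.2 (key E h.1 E' h.2.1 h.2.2.1 ⟨h.2.2.2.1, h.2.2.2.2.1⟩)

end Planarization

/-! ### Chords of crossing pairs -/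

section Chords

variable {V : Type*} {G Ghat : SimpleGraph V} {D : Drawing G} {S : Set CrossingType}

/-- `g` joins an endpoint of each of the two crossing edges of `P`, and is a chord of the
4-cycle through them. -/
def Drawing.IsChordOf (D : Drawing G) (Ghat : SimpleGraph V) (P : Sym2 (Sym2 V))
    (g : Sym2 V) : Prop :=
  ∃ u v x y p, g = s(u, v) ∧ P = s(s(u, x), s(v, y)) ∧ D.Crosses s(u, x) s(v, y) p ∧
    G.Adj x v ∧ G.Adj y u ∧ Ghat.Adj u v

lemma Drawing.IsChordOf.exists_ends {P : Sym2 (Sym2 V)} {u v : V}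
    (h : D.IsChordOf Ghat P s(u, v)) : ∃ x y p, P = s(s(u, x), s(v, y)) ∧
      D.Crosses s(u, x) s(v, y) p ∧ G.Adj x v ∧ G.Adj y u := by
  obtain ⟨u', v', x, y, p, h1, h2, h3, h4, h5, -⟩ := h
  rcases Sym2.eq_iff.1 h1 with ⟨rfl, rfl⟩ | ⟨rfl, rfl⟩
  · exact ⟨x, y, p, h2, h3, h4, h5⟩
  · exact ⟨y, x, p, h2.trans Sym2.eq_swap, h3.symm, h5, h4⟩

lemma HasCrossingType.adj_of_mem_goodTypes {a b c d : V} {t : CrossingType}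
    (h : HasCrossingType G a b c d t) (ht : t ∈ goodTypes) :
    (G.Adj b c ∧ G.Adj d a) ∨ (G.Adj b d ∧ G.Adj c a) := by
  rcases ht with rfl | rfl | rfl <;>
    simp only [HasCrossingType, G.adj_comm d a, G.adj_comm c a] at h ⊢ <;> tauto

/-- In a chordal graph every 4-cycle has a diagonal. -/
lemma IsChordal.diagonal (h : IsChordal G) {a b c d : V} (hab : G.Adj a b) (hbc : G.Adj b c)
    (hcd : G.Adj c d) (hda : G.Adj d a) (hac : a ≠ c) (hbd : b ≠ d) :
    G.Adj a c ∨ G.Adj b d := by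
  let w : G.Walk a a := .cons hab (.cons hbc (.cons hcd (.cons hda .nil)))
  have hw : w.IsCycle := by
    have := hab.ne
    have := hbc.ne
    have := hcd.ne
    have := hda.ne
    simp [w, SimpleGraph.Walk.cons_isCycle_iff, SimpleGraph.Walk.cons_isPath_iff]
    grind
  obtain ⟨p, q, hp, hq, hpq, hne⟩ := h a w hw (by simp [w])
  simp only [w, SimpleGraph.Walk.support_cons, SimpleGraph.Walk.support_nil,
    SimpleGraph.Walk.edges_cons, SimpleGraph.Walk.edges_nil, List.mem_cons, List.not_mem_nil,
    or_false, not_or] at hp hq hne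
  have := hpq.ne
  have := hpq.symm
  rcases hp with rfl | rfl | rfl | rfl | rfl <;> rcases hq with rfl | rfl | rfl | rfl | rfl <;>
    simp_all

lemma Drawing.IsSRestricted.exists_chord (hD : D.IsSRestricted S) (hS : S ⊆ goodTypes)
    (hsub : G ≤ Ghat) (hchordal : IsChordal Ghat) {P : Sym2 (Sym2 V)}
    (hP : P ∈ D.crossingPairs) : ∃ g, D.IsChordOf Ghat P g := by
  have main : ∀ a b c d p, D.Crosses s(a, b) s(c, d) p → G.Adj b c → G.Adj d a →
      ∃ g, D.IsChordOf Ghat s(s(a, b), s(c, d)) g := by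
    intro a b c d p h hbc hda
    have hdis := hD.1.2 _ _ _ h
    have hac : a ≠ c := by
      rintro rfl
      exact hdis a (Sym2.mem_mk_left _ _) (Sym2.mem_mk_left _ _)
    have hbd : b ≠ d := by
      rintro rfl
      exact hdis b (Sym2.mem_mk_right _ _) (Sym2.mem_mk_right _ _)
    rcases hchordal.diagonal (hsub h.1) (hsub hbc) (hsub h.2.1) (hsub hda) hac hbd with h1 | h1
    · exact ⟨_, a, c, b, d, p, rfl, rfl, h, hbc, hda, h1⟩
    · have hsw : s(s(a, b), s(c, d)) = s(s(b, a), s(d, c)) := by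
        rw [Sym2.eq_swap (a := a), Sym2.eq_swap (a := c)]
      refine ⟨_, b, d, a, c, p, rfl, hsw, ?_, hda.symm, hbc.symm, h1⟩
      rwa [Sym2.eq_swap (a := b), Sym2.eq_swap (a := d)]
  obtain ⟨e, f, p, rfl, h⟩ := hP
  induction e with | h a b =>
  induction f with | h c d =>
  obtain ⟨t, ht, hty⟩ := hD.2 _ _ _ _ _ h
  rcases hty.adj_of_mem_goodTypes (hS ht) with ⟨h1, h2⟩ | ⟨h1, h2⟩
  · exact main a b c d p h h1 h2
  · rw [Sym2.eq_swap (a := c)] at h ⊢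
    exact main a b d c p h h1 h2

lemma Drawing.IsChordOf.isChordTiedPair (hD : D.IsSRestricted S) {P : Sym2 (Sym2 V)} {g : Sym2 V}
    (h : D.IsChordOf Ghat P g) {e : Sym2 V} (he : e ∈ P) : IsChordTiedPair G Ghat S e g := by
  have main : ∀ u v x y p, D.Crosses s(u, x) s(v, y) p → G.Adj x v → G.Adj y u → Ghat.Adj u v →
      IsChordTiedPair G Ghat S s(u, x) s(u, v) := by
    intro u v x y p hc hxv hyu huv
    refine ⟨u, x, v, y, rfl, hc.1, hxv, hc.2.1, hyu, hD.2 _ _ _ _ _ hc, huv, by simp, ?_⟩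
    have h1 := (show G.Adj u x from hc.1).ne
    have h2 := (show G.Adj v y from hc.2.1).ne
    have h3 := huv.ne
    have h4 := hxv.ne
    have h5 := hyu.ne
    simp only [Set.mem_insert_iff, Set.mem_singleton_iff, Sym2.eq_iff]
    grind
  obtain ⟨u, v, x, y, p, rfl, rfl, hc, hxv, hyu, huv⟩ := h
  rcases Sym2.mem_iff.1 he with rfl | rfl
  · exact main u v x y p hc hxv hyu huv
  · rw [Sym2.eq_swap (a := u)]
    exact main v u y x p hc.symm hyu hxv huv.symm

/-- In a drawing without twin crossings of an internally 3-connected graph, no three crossing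
pairs share a chord. -/
lemma Drawing.IsOnePlanar.not_three_chords [Finite V] (hD : D.IsOnePlanar)
    (hno : ∀ u v x y c, ¬ D.IsTwinCrossing u v x y c) (hG : InternallyThreeConnected G)
    {P : Fin 3 → Sym2 (Sym2 V)} (hP : Function.Injective P) {g : Sym2 V} :
    ¬ ∀ i, D.IsChordOf Ghat (P i) g := by
  intro h
  induction g with | h u v =>
  have huv : u ≠ v := by
    obtain ⟨u', v', _, _, _, h1, -, -, -, -, h2⟩ := h 0
    have : Ghat.Adj u v := by
      rw [← SimpleGraph.mem_edgeSet, h1]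
      exact h2
    exact this.ne
  choose x y p hPxy hc hxv hyu using fun i => (h i).exists_ends
  obtain ⟨Ws, hdeg, -, -, hcon⟩ := hG
  have hx : Function.Injective x := by
    intro i j hij
    have h1 := hc j
    rw [← hij] at h1
    refine hP ?_
    rw [hPxy, hPxy, ← hij, (hD.1 _ _ _ _ _ (hc i) h1).1]
  have hy : Function.Injective y := by
    intro i j hij
    have h1 := (hc j).symm
    rw [← hij] at h1
    refine hP ?_
    rw [hPxy, hPxy, ← hij, (hD.1 _ _ _ _ _ (hc i).symm h1).1]
  have hdeg' : ∀ w, ∀ f : Fin 3 → V, Function.Injective f → (∀ i, G.Adj w (f i)) → w ∉ Ws := by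
    intro w f hf hw hW
    obtain ⟨a, b, -, hN⟩ := hdeg w hW
    have hsub : Set.range f ⊆ {a, b} := by
      rintro _ ⟨i, rfl⟩
      exact hN ▸ hw i
    have h1 := Set.ncard_le_ncard hsub (Set.toFinite _)
    rw [← Set.image_univ, Set.ncard_image_of_injective _ hf, Set.ncard_univ, Nat.card_fin] at h1
    have := Set.ncard_insert_le a {b}
    rw [Set.ncard_singleton] at this
    omega
  have huW : u ∉ Ws := hdeg' u x hx fun i => (hc i).1
  have hvW : v ∉ Ws := hdeg' v y hy fun i => (hc i).2.1
  have htwin : ∀ w ∈ Ws, G.Adj w u → G.Adj w v → ∀ z, G.Adj w z ↔ z = u ∨ z = v := by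
    intro w hw hu hv z
    obtain ⟨a, b, -, hN⟩ := hdeg w hw
    have hN' : ∀ z, G.Adj w z ↔ z = a ∨ z = b := fun z => by
      rw [← SimpleGraph.mem_neighborSet, hN]; rfl
    rw [hN'] at hu hv ⊢
    grind
  have hz : ∀ i, ∃ z, (z = x i ∨ z = y i) ∧ z ∉ Ws := by
    intro i
    by_contra! hcon
    have hxW := hcon (x i) (.inl rfl)
    have hyW := hcon (y i) (.inr rfl)
    refine hno u v (x i) (y i) (p i) ⟨huv, fun hxy => ?_,
      htwin _ hxW (show G.Adj u (x i) from (hc i).1).symm (hxv i),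
      htwin _ hyW (hyu i) (show G.Adj v (y i) from (hc i).2.1).symm, hc i⟩
    exact hD.2 _ _ _ (hc i) (x i) (Sym2.mem_mk_right _ _) (hxy ▸ Sym2.mem_mk_right _ _)
  choose z hz hzW using hz
  have hzm : ∀ i, z i ∈ ({u, v} : Set V)ᶜ := by
    rintro i (h1 | h1) <;> rcases hz i with h2 | h2 <;> rw [h1] at h2
    · exact (show G.Adj u (x i) from (hc i).1).ne h2
    · exact (hyu i).ne h2.symm
    · exact (hxv i).ne h2.symm
    · exact (show G.Adj v (y i) from (hc i).2.1).ne h2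
  let T : Set {w // w ∉ Ws} := {⟨u, huW⟩, ⟨v, hvW⟩}
  have hT : T.ncard < 3 := by
    have := Set.ncard_insert_le (⟨u, huW⟩ : {w // w ∉ Ws}) {⟨v, hvW⟩}
    rw [Set.ncard_singleton] at this
    exact Nat.lt_succ_of_le this
  have hTm : ∀ w : {w // w ∉ Ws}, w ∈ Tᶜ → w.1 ∈ ({u, v} : Set V)ᶜ := by
    rintro w hw (h1 | h1)
    · exact hw (.inl (Subtype.ext h1))
    · exact hw (.inr (Subtype.ext h1))
  have hTm' : ∀ w : {w // w ∉ Ws}, w.1 ∈ ({u, v} : Set V)ᶜ → w ∈ Tᶜ := by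
    rintro w hw (h1 | h1)
    · exact hw (.inl (congrArg Subtype.val h1))
    · exact hw (.inr (congrArg Subtype.val h1))
  have step : ∀ a b : V, ∀ ha : a ∈ ({u, v} : Set V)ᶜ, ∀ hb : b ∈ ({u, v} : Set V)ᶜ, G.Adj a b →
      (G.induce ({u, v} : Set V)ᶜ).Reachable ⟨a, ha⟩ ⟨b, hb⟩ := fun a b ha hb hab =>
    SimpleGraph.Adj.reachable (by exact hab)
  have step' : ∀ a b : V, ∀ ha : a ∈ ({u, v} : Set V)ᶜ, ∀ hb : b ∈ ({u, v} : Set V)ᶜ,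
      (G.Adj a b ∨ ∃ w ∈ Ws, G.Adj w a ∧ G.Adj w b) →
      (G.induce ({u, v} : Set V)ᶜ).Reachable ⟨a, ha⟩ ⟨b, hb⟩ := by
    rintro a b ha hb (h1 | ⟨w, hw, h1, h2⟩)
    · exact step a b ha hb h1
    · have hw' : w ∈ ({u, v} : Set V)ᶜ := by
        rintro (rfl | rfl)
        exacts [huW hw, hvW hw]
      exact (step a w ha hw' h1.symm).trans (step w b hw' hb h2)
  have walk : ∀ a b : (Tᶜ : Set {w // w ∉ Ws}), ((suppress G Ws).induce Tᶜ).Walk a b →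
      (G.induce ({u, v} : Set V)ᶜ).Reachable ⟨a.1.1, hTm _ a.2⟩ ⟨b.1.1, hTm _ b.2⟩ := by
    intro a b w
    induction w with
    | nil => exact SimpleGraph.Reachable.refl _
    | cons hab _ ih =>
      refine SimpleGraph.Reachable.trans ?_ ih
      rcases hab.2 with h1 | h1
      · exact step' _ _ _ _ h1
      · exact (step' _ _ _ _ h1).symm
  refine hD.not_three_crossings huv hc hx hz hzm fun i => ?_
  obtain ⟨w⟩ := (hcon T hT).preconnected ⟨⟨z 0, hzW 0⟩, hTm' _ (hzm 0)⟩
    ⟨⟨z i, hzW i⟩, hTm' _ (hzm i)⟩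
  exact walk _ _ w

/-- A function with fibres of size at most two becomes injective after adding a flag. -/
lemma exists_flag {α β : Type*} {s : Set α} {f : α → β}
    (h : ∀ φ : Fin 3 → α, Function.Injective φ → (∀ i, φ i ∈ s) → ∃ i, f (φ i) ≠ f (φ 0)) :
    ∃ b : α → Bool, ∀ x ∈ s, ∀ y ∈ s, f x = f y → b x = b y → x = y := by
  classical
  obtain hα | hα := isEmpty_or_nonempty α
  · exact ⟨fun _ => true, fun x => isEmptyElim x⟩
  have hr : ∀ z, ∃ r, ∀ x ∈ s, f x = z → r ∈ s ∧ f r = z := fun z => by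
    by_cases hz : ∃ r ∈ s, f r = z
    · obtain ⟨r, hr⟩ := hz
      exact ⟨r, fun _ _ _ => hr⟩
    · exact ⟨hα.some, fun x hx hxz => absurd ⟨x, hx, hxz⟩ hz⟩
  choose r hr using hr
  refine ⟨fun x => decide (x = r (f x)), fun x hx y hy hxy hb => ?_⟩
  by_contra hne
  obtain ⟨h1, h2⟩ := hr (f x) x hx rfl
  have hb' : x = r (f x) ↔ y = r (f x) := by
    beta_reduce at hb
    rw [← hxy] at hb
    exact decide_eq_decide.1 hb
  have hx' : x ≠ r (f x) := fun h' => hne (h'.trans (hb'.1 h').symm)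
  have hy' : y ≠ r (f x) := fun h' => hx' (hb'.2 h')
  have hinj : Function.Injective ![x, y, r (f x)] := by
    intro i j hij
    fin_cases i <;> fin_cases j <;> simp_all
  have hmem : ∀ i, ![x, y, r (f x)] i ∈ s := by
    intro i
    fin_cases i
    exacts [hx, hy, h1]
  obtain ⟨i, hi⟩ := h _ hinj hmem
  apply hi
  fin_cases i
  exacts [rfl, hxy.symm, h2]

end Chords

/-- **From a drawing to a chord description.** Let `S ⊆ {full, almost-full, bowtie}` be
nonempty, `Ĝ` a chordal completion of `G`, and let `G` be an internally 3-connected graph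
that admits an `S`-restricted drawing.  Then `G` has a chord description `Ψ`; moreover the
flags can be chosen so that at most two chord-tied pairs of `Ψ` carry the same chord edge
and flag. -/
theorem drawing_to_chord_description {V : Type*} [Fintype V]
    (G Ghat : SimpleGraph V) (hsub : G ≤ Ghat) (hchordal : IsChordal Ghat)
    (S : Set CrossingType) (hS : S ⊆ goodTypes) (hne : S.Nonempty)
    (hi3c : InternallyThreeConnected G)
    (hdraw : SRestricted G S) :
    ∃ Ψ : Set (Sym2 V × Sym2 V × Bool), IsChordDescription G Ghat S Ψ ∧
      ∀ (g : Sym2 V) (b : Bool), {e : Sym2 V | (e, g, b) ∈ Ψ}.ncard ≤ 2 := by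
  obtain ⟨D, hD, hno⟩ := hdraw.exists_noTwinCrossing
  obtain ⟨c, hc⟩ : ∃ c : Sym2 (Sym2 V) → Sym2 V,
      ∀ P ∈ D.crossingPairs, D.IsChordOf Ghat P (c P) := by
    classical
    choose c hc using fun P (hP : P ∈ D.crossingPairs) => hD.exists_chord hS hsub hchordal hP
    exact ⟨fun P => if hP : P ∈ D.crossingPairs then c P hP else (Quot.out P).1,
      fun P hP => by simpa [hP] using hc P hP⟩
  obtain ⟨flag, hflag⟩ := exists_flag (s := D.crossingPairs) (f := c) fun φ hφ hφs => by
    by_contra! hcon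
    exact hD.1.not_three_chords hno hi3c hφ fun i => hcon i ▸ hc _ (hφs i)
  let Ψ : Set (Sym2 V × Sym2 V × Bool) :=
    {ψ | ∃ P ∈ D.crossingPairs, ψ.1 ∈ P ∧ ψ.2.1 = c P ∧ ψ.2.2 = flag P}
  have hpartner : ∀ e e' g b, (e, g, b) ∈ Ψ → (e', g, b) ∈ Ψ →
      ∃ P ∈ D.crossingPairs, e ∈ P ∧ e' ∈ P ∧ g = c P ∧ b = flag P := by
    rintro e e' g b ⟨P, hP, he, hg, hb⟩ ⟨P', hP', he', hg', hb'⟩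
    obtain rfl := hflag P hP P' hP' (hg.symm.trans hg') (hb.symm.trans hb')
    exact ⟨P, hP, he, he', hg, hb⟩
  have hpair : ∀ e e', CrossingPairOf Ψ e e' ↔ ∃ p, D.Crosses e e' p := by
    intro e e'
    constructor
    · rintro ⟨hne, g, b, h1, h2⟩
      obtain ⟨P, hP, he, he', -⟩ := hpartner e e' g b h1 h2
      obtain ⟨p, hp⟩ := D.exists_crosses_of_mem hP
      obtain ⟨f, rfl, hf⟩ := hp e he
      obtain rfl := (Sym2.mem_iff.1 he').resolve_left hne.symm
      exact ⟨p, hf⟩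
    · rintro ⟨p, hp⟩
      have hP := hp.mem_crossingPairs
      exact ⟨hp.2.2.1, _, _, ⟨_, hP, Sym2.mem_mk_left _ _, rfl, rfl⟩,
        ⟨_, hP, Sym2.mem_mk_right _ _, rfl, rfl⟩⟩
  have hCP : crossingPairsOf Ψ = D.crossingPairs := by
    ext P
    constructor
    · rintro ⟨e, e', h, rfl⟩
      obtain ⟨p, hp⟩ := (hpair e e').1 h
      exact hp.mem_crossingPairs
    · rintro ⟨e, e', p, rfl, hp⟩
      exact ⟨e, e', (hpair e e').2 ⟨p, hp⟩, rfl⟩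
  refine ⟨Ψ, ⟨?_, ?_, ?_, hCP ▸ hD.1.isPlanarGraph_planarizationBy, ?_⟩, ?_⟩
  · rintro ⟨e, g, b⟩ ⟨P, hP, he, rfl, -⟩
    exact (hc P hP).isChordTiedPair hD he
  · rintro ⟨e, g, b⟩ ⟨P, hP, he, rfl, rfl⟩
    obtain ⟨p, hp⟩ := D.exists_crosses_of_mem hP
    obtain ⟨f, hPf, hf⟩ := hp e he
    refine ⟨f, ⟨hf.2.2.1.symm, P, hP, hPf ▸ Sym2.mem_mk_right _ _, rfl, rfl⟩, ?_⟩
    rintro f' ⟨hne, hf'⟩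
    obtain ⟨Q, hQ, heQ, hfQ, -⟩ :=
      hpartner e f' _ _ ⟨P, hP, he, rfl, rfl⟩ hf'
    obtain rfl := hD.1.eq_of_mem_crossingPairs hP hQ he heQ
    rw [hPf] at hfQ
    exact (Sym2.mem_iff.1 hfQ).resolve_left hne
  · rintro e g g' b b' ⟨P, hP, he, rfl, rfl⟩ ⟨P', hP', he', rfl, rfl⟩
    obtain rfl := hD.1.eq_of_mem_crossingPairs hP hP' he he'
    exact ⟨rfl, rfl⟩
  · intro e e' h
    obtain ⟨p, hp⟩ := (hpair e e').1 h
    induction e with | h a b =>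
    induction e' with | h a' b' =>
    exact ⟨a, b, a', b', rfl, rfl, hD.2 _ _ _ _ _ hp⟩
  · intro g b
    by_cases h : ∃ P ∈ D.crossingPairs, g = c P ∧ b = flag P
    · obtain ⟨P, hP, rfl, rfl⟩ := h
      have hsubP : {e : Sym2 V | (e, c P, flag P) ∈ Ψ} ⊆ {e | e ∈ P} := by
        rintro e ⟨Q, hQ, he, h1, h2⟩
        obtain rfl := hflag P hP Q hQ h1 h2
        exact he
      refine (Set.ncard_le_ncard hsubP (Set.toFinite _)).trans ?_
      induction P with | h e f =>
      have : {e' | e' ∈ s(e, f)} = {e, f} := by ext; simp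
      rw [this]
      have := Set.ncard_insert_le e {f}
      rwa [Set.ncard_singleton] at this
    · have : {e : Sym2 V | (e, g, b) ∈ Ψ} = ∅ :=
        Set.eq_empty_of_forall_notMem fun e ⟨P, hP, _, h1, h2⟩ => h ⟨P, hP, h1, h2⟩
      rw [this, Set.ncard_empty]
      exact Nat.zero_le _

end OnePlanarity
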